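/- arXiv:2202.07554 — 10 statements merged into one kernel-verified Lean document; each statement's English description precedes it below -/
import Mathlib

section
/- Let u ∈ X be arbitrary. Then the Optimistic FTRL iterates satisfy the regret bound Σ_{t=1}^T ⟨g_t, x_t − u⟩ ≤ D²/η_{T+1} + Σ_{t=1}^T ( ⟨g_t − M_t, x_t − x_{t+1}⟩ − (1/η_t)·‖x_{t+1} − x_t‖² ). -/
open Finset RealInnerProductSpace

/-- Quadratic growth of a regularized linear function around its minimizer on a convex set. -/
theorem quadratic_growth_of_isMinOn {E : Type*} [NormedAddCommGroup E] [InnerProductSpace ℝ E]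
    {X : Set E} (hX : Convex ℝ X) {η : ℝ} (hη : 0 < η) {v x y : E} (hx : x ∈ X) (hy : y ∈ X)
    (hmin : IsMinOn (fun z ↦ ⟪z, v⟫ + ‖z‖ ^ 2 / η) X x) :
    ⟪x, v⟫ + ‖x‖ ^ 2 / η + ‖y - x‖ ^ 2 / η ≤ ⟪y, v⟫ + ‖y‖ ^ 2 / η := by
  have hseg : ∀ s : ℝ, 0 < s → s ≤ 1 →
      ⟪x, v⟫ + ‖x‖ ^ 2 / η + (1 - s) * (‖y - x‖ ^ 2 / η) ≤ ⟪y, v⟫ + ‖y‖ ^ 2 / η := by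
    intro s hs hs1
    have h := isMinOn_iff.mp hmin _
      (hX hx hy (sub_nonneg.mpr hs1) hs.le (sub_add_cancel 1 s))
    have hnorm : ‖(1 - s) • x + s • y‖ ^ 2 =
        (1 - s) * ‖x‖ ^ 2 + s * ‖y‖ ^ 2 - s * (1 - s) * ‖y - x‖ ^ 2 := by
      rw [norm_add_sq_real, norm_sub_sq_real, real_inner_smul_left, real_inner_smul_right,
        norm_smul, norm_smul, mul_pow, mul_pow, Real.norm_eq_abs, Real.norm_eq_abs, sq_abs,
        sq_abs, real_inner_comm x y]
      ring
    simp only [hnorm, inner_add_left, real_inner_smul_left, sub_div, add_div, mul_div_assoc] at h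
    refine le_of_mul_le_mul_left ?_ hs
    linarith
  by_contra! hlt
  have hc : 0 ≤ ‖y - x‖ ^ 2 / η := by positivity
  set c := ‖y - x‖ ^ 2 / η
  set a := ⟪x, v⟫ + ‖x‖ ^ 2 / η + c - (⟪y, v⟫ + ‖y‖ ^ 2 / η) with ha
  have ha0 : 0 < a := sub_pos.mpr hlt
  have h := hseg (a / (a + c)) (by positivity) ((div_le_one (by positivity)).mpr (by linarith))
  have hle : a ≤ a / (a + c) * c := by linarith
  rw [div_mul_eq_mul_div, le_div_iff₀ (by positivity)] at hle
  nlinarith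

/-- Optimistic FTRL regret bound (Lemma on OFTRL for convex losses). -/
theorem stmt_0 {E : Type*} [NormedAddCommGroup E] [InnerProductSpace ℝ E]
    (D : ℝ) (hD : 0 < D)
    (X : Set E) (hXne : X.Nonempty) (hXconv : Convex ℝ X)
    (hXbdd : ∀ x ∈ X, ‖x‖ ≤ D)
    (T : ℕ) (hT : 1 ≤ T)
    (g M : ℕ → E) (hMT : M (T + 1) = 0)
    (η : ℕ → ℝ)
    (hηpos : ∀ t ∈ Finset.Icc 1 (T + 1), 0 < η t)
    (hηdec : ∀ t ∈ Finset.Icc 1 T, η (t + 1) ≤ η t)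
    (x : ℕ → E)
    (hxX : ∀ t ∈ Finset.Icc 1 (T + 1), x t ∈ X)
    (hxmin : ∀ t ∈ Finset.Icc 1 (T + 1), ∀ y ∈ X,
      ⟪x t, M t + ∑ s ∈ Finset.Icc 1 (t - 1), g s⟫ + ‖x t‖ ^ 2 / η t ≤
        ⟪y, M t + ∑ s ∈ Finset.Icc 1 (t - 1), g s⟫ + ‖y‖ ^ 2 / η t)
    (u : E) (hu : u ∈ X) :
    ∑ t ∈ Finset.Icc 1 T, ⟪g t, x t - u⟫ ≤
      D ^ 2 / η (T + 1) +
        ∑ t ∈ Finset.Icc 1 T,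
          (⟪g t - M t, x t - x (t + 1)⟫ - (1 / η t) * ‖x (t + 1) - x t‖ ^ 2) := by
  have hkey : ∀ n ≤ T, ∑ t ∈ Finset.Icc 1 n,
      (⟪g t, x t⟫ - ⟪g t - M t, x t - x (t + 1)⟫ + (1 / η t) * ‖x (t + 1) - x t‖ ^ 2) ≤
        ⟪x (n + 1), ∑ s ∈ Finset.Icc 1 n, g s⟫ + ‖x (n + 1)‖ ^ 2 / η (n + 1) := by
    intro n
    induction n with
    | zero =>
      intro _
      have := hηpos 1 (by simp)
      simp only [zero_lt_one, Finset.Icc_eq_empty_of_lt, Finset.sum_empty, inner_zero_right,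
        zero_add]
      positivity
    | succ n ih =>
      intro hn
      have hmem : n + 1 ∈ Finset.Icc 1 (T + 1) := Finset.mem_Icc.mpr ⟨by lia, by lia⟩
      have hmem' : n + 1 + 1 ∈ Finset.Icc 1 (T + 1) := Finset.mem_Icc.mpr ⟨by lia, by lia⟩
      have hprev := ih (by lia)
      have hgrowth := quadratic_growth_of_isMinOn hXconv (hηpos _ hmem) (hxX _ hmem)
        (hxX _ hmem') (isMinOn_iff.mpr (hxmin _ hmem))
      have hstep : ‖x (n + 1 + 1)‖ ^ 2 / η (n + 1) ≤ ‖x (n + 1 + 1)‖ ^ 2 / η (n + 1 + 1) :=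
        div_le_div_of_nonneg_left (sq_nonneg _) (hηpos _ hmem')
          (hηdec _ (Finset.mem_Icc.mpr ⟨by lia, hn⟩))
      rw [Finset.sum_Icc_succ_top (by lia), Finset.sum_Icc_succ_top (by lia)]
      simp only [Nat.add_sub_cancel, inner_add_right, inner_sub_left, inner_sub_right,
        one_div_mul_eq_div, real_inner_comm (x _) (g _), real_inner_comm (x _) (M _)]
        at hprev hgrowth ⊢
      linarith
  have hfinal := hxmin (T + 1) (Finset.mem_Icc.mpr ⟨by lia, le_rfl⟩) u hu
  have hηT := hηpos (T + 1) (Finset.mem_Icc.mpr ⟨by lia, le_rfl⟩)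
  have hbound : ‖u‖ ^ 2 / η (T + 1) ≤ D ^ 2 / η (T + 1) := by
    gcongr
    exact hXbdd u hu
  have hsum := hkey T le_rfl
  have hu_sum : ⟪u, ∑ s ∈ Finset.Icc 1 T, g s⟫ = ∑ s ∈ Finset.Icc 1 T, ⟪g s, u⟫ := by
    rw [real_inner_comm, sum_inner]
  rw [Nat.add_sub_cancel, hMT, zero_add, hu_sum] at hfinal
  simp only [inner_sub_right (g _) (x _) u, Finset.sum_add_distrib, Finset.sum_sub_distrib]
    at hsum ⊢
  linarith
end

section
/- With g_t = ∇f_t(x_t) and M_t = ∇m_t(x_t), for every u ∈ X one has Σ_{t=1}^T ( f_t(x_t) − f_t(u) ) ≤ Σ_{t=1}^T ( ⟨g_t − M_t, x_t − x_{t+1}⟩ − (t·μ/2)·‖x_t − x_{t+1}‖² ). -/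
open Finset RealInnerProductSpace

/-- First-order optimality condition for a minimizer over a convex set. -/
theorem IsMinOn.hasFDerivAt_sub_nonneg {E : Type*} [NormedAddCommGroup E] [NormedSpace ℝ E]
    {X : Set E} (hX : Convex ℝ X) {F : E → ℝ} {F' : E →L[ℝ] ℝ} {x y : E}
    (hmin : IsMinOn F X x) (hF : HasFDerivAt F F' x) (hx : x ∈ X) (hy : y ∈ X) :
    0 ≤ F' (y - x) :=
  hmin.localize.hasFDerivWithinAt_nonneg hF.hasFDerivWithinAt
    (sub_mem_posTangentConeAt_of_segment_subset (hX.segment_subset hx hy))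

/-- First-order lower bound for a strongly convex function. -/
theorem StrongConvexOn.sub_le_of_hasFDerivAt {E : Type*} [NormedAddCommGroup E] [NormedSpace ℝ E]
    {X : Set E} {μ : ℝ} {F : E → ℝ} {F' : E →L[ℝ] ℝ} {x y : E}
    (hsc : StrongConvexOn X μ F) (hF : HasFDerivAt F F' x) (hx : x ∈ X) (hy : y ∈ X) :
    F x - F y ≤ F' (x - y) - μ / 2 * ‖x - y‖ ^ 2 := by
  set c := μ / 2 * ‖x - y‖ ^ 2 with hc
  let h : ℝ → ℝ := fun s => (1 - s) * F x + s * F y - (1 - s) * s * c - F (x + s • (y - x))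
  have hline : HasDerivAt (fun s : ℝ => x + s • (y - x)) (y - x) 0 := by
    simpa using ((hasDerivAt_id (0 : ℝ)).smul_const (y - x)).const_add x
  have hcomp : HasDerivAt (fun s : ℝ => F (x + s • (y - x))) (F' (y - x)) 0 :=
    HasFDerivAt.comp_hasDerivAt (0 : ℝ) (by simpa using hF) hline
  have hid := hasDerivAt_id (0 : ℝ)
  have hderiv : HasDerivAt h (F y - F x - c - F' (y - x)) 0 := by
    refine (((((hid.const_sub 1).mul_const (F x)).add (hid.mul_const (F y))).sub
      (((hid.const_sub 1).mul hid).mul_const c)).sub hcomp).congr_deriv ?_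
    simp only [id_eq]
    ring
  have hmin : IsMinOn h (Set.Icc 0 1) 0 := by
    intro s hs
    have key := hsc.2 hx hy (sub_nonneg.2 hs.2) hs.1 (by ring)
    have hpt : (1 - s) • x + s • y = x + s • (y - x) := by module
    rw [hpt] at key
    simp only [smul_eq_mul, ← hc] at key
    simp only [Set.mem_ofPred_eq, h, zero_smul, add_zero]
    linarith
  have hnonneg := hmin.hasFDerivAt_sub_nonneg (convex_Icc 0 1) hderiv.hasFDerivAt
    (Set.left_mem_Icc.2 zero_le_one) (Set.right_mem_Icc.2 zero_le_one)
  have hneg : F' (y - x) = -F' (x - y) := by rw [← map_neg, neg_sub]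
  rw [ContinuousLinearMap.toSpanSingleton_apply, sub_zero, one_smul] at hnonneg
  linarith

/-- The "be the leader" telescoping identity. -/
theorem sum_sub_leader_eq {E : Type*} (f : ℕ → E → ℝ) (x : ℕ → E) (T : ℕ) :
    ∑ t ∈ Finset.Icc 1 T, f t (x t) - ∑ t ∈ Finset.Icc 1 T, f t (x (T + 1)) =
      ∑ t ∈ Finset.Icc 1 T, ∑ s ∈ Finset.Icc 1 t, (f s (x t) - f s (x (t + 1))) := by
  induction T with
  | zero => simp
  | succ n ih =>
    rw [Finset.sum_Icc_succ_top (by omega) (fun t => ∑ s ∈ Finset.Icc 1 t, _), ← ih,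
      Finset.sum_sub_distrib, Finset.sum_Icc_succ_top (by omega) (fun t => f t (x t)),
      Finset.sum_Icc_succ_top (by omega) (fun s => f s (x (n + 1)))]
    ring

/-- Optimistic FTL regret bound for strongly convex losses. -/
theorem stmt_1 {E : Type*} [NormedAddCommGroup E] [InnerProductSpace ℝ E]
    (X : Set E) (hXne : X.Nonempty) (hXconv : Convex ℝ X)
    (μ : ℝ) (hμ : 0 < μ) (T : ℕ) (hT : 1 ≤ T)
    (f m : ℕ → E → ℝ)
    (hfdiff : ∀ t ∈ Finset.Icc 1 T, Differentiable ℝ (f t))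
    (hfsc : ∀ t ∈ Finset.Icc 1 T, StrongConvexOn Set.univ μ (f t))
    (hmdiff : ∀ t ∈ Finset.Icc 1 T, Differentiable ℝ (m t))
    (hmconv : ∀ t ∈ Finset.Icc 1 T, ConvexOn ℝ Set.univ (m t))
    (x : ℕ → E) (hxX : ∀ t ∈ Finset.Icc 1 (T + 1), x t ∈ X)
    (g M : ℕ → E)
    (hg : ∀ t ∈ Finset.Icc 1 T,
      HasFDerivAt (f t) ((InnerProductSpace.toDualMap ℝ E) (g t) : E →L[ℝ] ℝ) (x t))
    (hM : ∀ t ∈ Finset.Icc 1 T,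
      HasFDerivAt (m t) ((InnerProductSpace.toDualMap ℝ E) (M t) : E →L[ℝ] ℝ) (x t))
    (hxmin : ∀ t ∈ Finset.Icc 1 T, ∀ y ∈ X,
      ∑ s ∈ Finset.Icc 1 (t - 1), f s (x t) + m t (x t) ≤
        ∑ s ∈ Finset.Icc 1 (t - 1), f s y + m t y)
    (hxlast : ∀ y ∈ X,
      ∑ s ∈ Finset.Icc 1 T, f s (x (T + 1)) ≤ ∑ s ∈ Finset.Icc 1 T, f s y)
    (u : E) (hu : u ∈ X) :
    ∑ t ∈ Finset.Icc 1 T, (f t (x t) - f t u) ≤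
      ∑ t ∈ Finset.Icc 1 T,
        (⟪g t - M t, x t - x (t + 1)⟫ - ((t : ℝ) * μ / 2) * ‖x t - x (t + 1)‖ ^ 2) := by
  have hu' := hxlast u hu
  rw [Finset.sum_sub_distrib]
  have htel := sum_sub_leader_eq f x T
  refine le_trans (b := ∑ t ∈ Finset.Icc 1 T, ∑ s ∈ Finset.Icc 1 t,
    (f s (x t) - f s (x (t + 1)))) (by linarith) (Finset.sum_le_sum fun t ht => ?_)
  have htT := Finset.mem_Icc.1 ht
  have hmem : ∀ s ∈ Finset.Icc 1 t, s ∈ Finset.Icc 1 T := fun s hs => by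
    simp only [Finset.mem_Icc] at hs ⊢
    omega
  have hxt : x t ∈ X := hxX t (Finset.mem_Icc.2 (by omega))
  have hxt' : x (t + 1) ∈ X := hxX (t + 1) (Finset.mem_Icc.2 (by omega))
  have hsum : ∑ s ∈ Finset.Icc 1 t, (f s (x t) - f s (x (t + 1))) ≤
      ∑ s ∈ Finset.Icc 1 t,
        (fderiv ℝ (f s) (x t) (x t - x (t + 1)) - μ / 2 * ‖x t - x (t + 1)‖ ^ 2) :=
    Finset.sum_le_sum fun s hs => (hfsc s (hmem s hs)).sub_le_of_hasFDerivAt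
      (hfdiff s (hmem s hs) (x t)).hasFDerivAt trivial trivial
  have hopt : HasFDerivAt (fun y => ∑ s ∈ Finset.Icc 1 (t - 1), f s y + m t y)
      (∑ s ∈ Finset.Icc 1 (t - 1), fderiv ℝ (f s) (x t) + InnerProductSpace.toDualMap ℝ E (M t))
      (x t) :=
    (HasFDerivAt.fun_sum fun s hs => (hfdiff s (hmem s (Finset.Icc_subset_Icc_right
      (Nat.sub_le t 1) hs)) (x t)).hasFDerivAt).add (hM t ht)
  have hmin : IsMinOn (fun y => ∑ s ∈ Finset.Icc 1 (t - 1), f s y + m t y) X (x t) :=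
    fun y hy => hxmin t ht y hy
  have hnonneg := hmin.hasFDerivAt_sub_nonneg hXconv hopt hxt hxt'
  rw [← neg_sub (x t) (x (t + 1)), map_neg] at hnonneg
  have hlast : ∑ s ∈ Finset.Icc 1 t, fderiv ℝ (f s) (x t) (x t - x (t + 1)) =
      ∑ s ∈ Finset.Icc 1 (t - 1), fderiv ℝ (f s) (x t) (x t - x (t + 1)) +
        ⟪g t, x t - x (t + 1)⟫ := by
    obtain ⟨n, rfl⟩ : ∃ n, t = n + 1 := ⟨t - 1, by omega⟩
    rw [Finset.sum_Icc_succ_top (by omega), (hg (n + 1) ht).fderiv]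
    simp
  refine hsum.trans ?_
  rw [Finset.sum_sub_distrib, hlast, Finset.sum_const, Nat.card_Icc, nsmul_eq_mul]
  simp only [add_apply, _root_.sum_apply,
    InnerProductSpace.toDualMap_apply_apply, add_tsub_cancel_right] at hnonneg ⊢
  rw [inner_sub_left]
  linarith
end

section
/- Suppose the parameter is tuned as ν = 2DG. Then the adaptive Optimistic FTRL iterates satisfy, for every u ∈ X, the deterministic worst-case regret bound Σ_{t=1}^T ⟨g_t, x_t − u⟩ ≤ 3√2·D·G·√T + 4·D·G. -/
open Finset RealInnerProductSpace

/-- A minimizer of the `σ`-quadratically regularized linear function over a convex set satisfies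
the quadratic growth inequality of strong convexity. -/
lemma quadratic_growth_of_minimizer {E : Type*} [NormedAddCommGroup E] [InnerProductSpace ℝ E]
    {X : Set E} (hX : Convex ℝ X) {σ : ℝ} {v x y : E} (hx : x ∈ X) (hy : y ∈ X)
    (hmin : ∀ z ∈ X, ⟪x, v⟫ + σ * ‖x‖ ^ 2 ≤ ⟪z, v⟫ + σ * ‖z‖ ^ 2) :
    ⟪x, v⟫ + σ * ‖x‖ ^ 2 + σ * ‖y - x‖ ^ 2 ≤ ⟪y, v⟫ + σ * ‖y‖ ^ 2 := by
  set P := ⟪y, v⟫ + σ * ‖y‖ ^ 2 - (⟪x, v⟫ + σ * ‖x‖ ^ 2) with hP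
  set Q := σ * ‖y - x‖ ^ 2 with hQ
  have segment_bound : ∀ l : ℝ, 0 < l → l < 1 → (1 - l) * Q ≤ P := by
    intro l hl0 hl1
    have h := hmin _ (hX hx hy (sub_nonneg.2 hl1.le) hl0.le (by ring))
    have hid : ⟪(1 - l) • x + l • y, v⟫ + σ * ‖(1 - l) • x + l • y‖ ^ 2
        - (⟪x, v⟫ + σ * ‖x‖ ^ 2) = l * (P - (1 - l) * Q) := by
      rw [hP, hQ]
      simp only [← real_inner_self_eq_norm_sq, inner_add_left, inner_add_right, inner_sub_left,
        inner_sub_right, real_inner_smul_left, real_inner_smul_right, real_inner_comm x y]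
      ring
    have : 0 ≤ l * (P - (1 - l) * Q) := by linarith
    linarith [nonneg_of_mul_nonneg_right this hl0]
  have hP0 : 0 ≤ P := by linarith [hmin y hy]
  suffices Q ≤ P by linarith
  by_contra! hlt
  have hQ0 : 0 < Q := hP0.trans_lt hlt
  have h := segment_bound ((Q - P) / (2 * Q)) (div_pos (by linarith) (by linarith))
    ((div_lt_one (by linarith)).2 (by linarith))
  have : (1 - (Q - P) / (2 * Q)) * Q = (Q + P) / 2 := by
    field_simp
    ring
  linarith

/-- Growth of a sequence with `a (n + 1) = a n + q n / a n` and bounded `q`. -/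
lemma self_bounded_growth {a q : ℕ → ℝ} {c : ℝ} {T : ℕ} (hc : 0 < c) (h0 : a 0 = 2 * c)
    (hq0 : ∀ n < T, 0 ≤ q n) (hq : ∀ n < T, q n ≤ 4 * c ^ 2)
    (hstep : ∀ n < T, a (n + 1) = a n + q n / a n) :
    ∀ n ≤ T, 2 * c ≤ a n ∧ (a n - c) ^ 2 ≤ c ^ 2 + 8 * c ^ 2 * n := by
  intro n
  induction n with
  | zero =>
    intro _
    rw [h0]
    refine ⟨le_rfl, le_of_eq ?_⟩
    push_cast
    ring
  | succ n ih =>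
    intro hn
    obtain ⟨hlow, hsq⟩ := ih (by omega)
    have hpos : 0 < a n := by linarith
    have hd0 : 0 ≤ q n / a n := div_nonneg (hq0 n hn) hpos.le
    have hd : q n / a n ≤ 2 * c := by
      rw [div_le_iff₀ hpos]
      nlinarith [hq n hn]
    have hmul : q n / a n * a n = q n := div_mul_cancel₀ _ hpos.ne'
    rw [hstep n hn]
    refine ⟨by linarith, ?_⟩
    push_cast
    nlinarith [hq n hn, mul_nonneg hd0 (sub_nonneg.2 hd)]

/-- Young's inequality for the inner product, with weight `s`. -/
lemma real_inner_le_weighted_sq {E : Type*} [NormedAddCommGroup E] [InnerProductSpace ℝ E]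
    {s : ℝ} (hs : 0 < s) (v w : E) : ⟪v, w⟫ ≤ s * ‖w‖ ^ 2 + s⁻¹ * ‖v‖ ^ 2 / 4 := by
  have h := real_inner_le_norm v w
  have hsq : s * ‖w‖ ^ 2 + s⁻¹ * ‖v‖ ^ 2 / 4 - ‖v‖ * ‖w‖
      = s * (‖w‖ - s⁻¹ * ‖v‖ / 2) ^ 2 := by
    field_simp
    ring
  nlinarith [mul_nonneg hs.le (sq_nonneg (‖w‖ - s⁻¹ * ‖v‖ / 2))]

/-- Adaptive Optimistic FTRL: worst-case regret bound with `ν = 2DG`. -/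
theorem stmt_2 {E : Type*} [NormedAddCommGroup E] [InnerProductSpace ℝ E]
    (D G ν : ℝ) (hD : 0 < D) (hG : 0 < G) (hν : 0 < ν)
    (X : Set E) (hXne : X.Nonempty) (hXconv : Convex ℝ X)
    (hXbdd : ∀ x ∈ X, ‖x‖ ≤ D)
    (T : ℕ) (hT : 1 ≤ T)
    (g M : ℕ → E)
    (hg : ∀ t ∈ Finset.Icc 1 T, ‖g t‖ ≤ G)
    (hMb : ∀ t ∈ Finset.Icc 1 T, ‖M t‖ ≤ G) (hMT : M (T + 1) = 0)
    (η : ℕ → ℝ)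
    (hη : ∀ t ∈ Finset.Icc 1 (T + 1),
      η t = D ^ 2 / (ν + ∑ s ∈ Finset.Icc 1 (t - 1), η s * ‖g s - M s‖ ^ 2))
    (x : ℕ → E) (hxX : ∀ t ∈ Finset.Icc 1 (T + 1), x t ∈ X)
    (hxmin : ∀ t ∈ Finset.Icc 1 (T + 1), ∀ y ∈ X,
      ⟪x t, M t + ∑ s ∈ Finset.Icc 1 (t - 1), g s⟫ + ‖x t‖ ^ 2 / η t ≤
        ⟪y, M t + ∑ s ∈ Finset.Icc 1 (t - 1), g s⟫ + ‖y‖ ^ 2 / η t)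
    (hνval : ν = 2 * D * G)
    (u : E) (hu : u ∈ X) :
    ∑ t ∈ Finset.Icc 1 T, ⟪g t, x t - u⟫ ≤
      3 * Real.sqrt 2 * D * G * Real.sqrt T + 4 * D * G := by
  set a : ℕ → ℝ := fun n => ν + ∑ s ∈ Finset.Icc 1 n, η s * ‖g s - M s‖ ^ 2 with ha
  have hc : 0 < D * G := mul_pos hD hG
  have hηa : ∀ n ≤ T, η (n + 1) = D ^ 2 / a n := by
    intro n hn
    simpa using hη (n + 1) (Finset.mem_Icc.2 ⟨by omega, by omega⟩)
  have ha0 : a 0 = ν := by simp [ha]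
  have hastep : ∀ n < T, a (n + 1) = a n + (D ^ 2 * ‖g (n + 1) - M (n + 1)‖ ^ 2) / a n := by
    intro n hn
    have h : a (n + 1) = a n + η (n + 1) * ‖g (n + 1) - M (n + 1)‖ ^ 2 := by
      simp only [ha]
      rw [Finset.sum_Icc_succ_top (by omega)]
      ring
    rw [h, hηa n hn.le]
    ring
  have hgrowth := self_bounded_growth (T := T) hc (by rw [ha0, hνval]; ring)
    (fun n _ => by positivity)
    (fun n hn => by
      have hmem : n + 1 ∈ Finset.Icc 1 T := Finset.mem_Icc.2 ⟨by omega, by omega⟩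
      have hδ : ‖g (n + 1) - M (n + 1)‖ ≤ 2 * G :=
        (norm_sub_le _ _).trans (by linarith [hg _ hmem, hMb _ hmem])
      calc D ^ 2 * ‖g (n + 1) - M (n + 1)‖ ^ 2 ≤ D ^ 2 * (2 * G) ^ 2 := by gcongr
        _ = 4 * (D * G) ^ 2 := by ring)
    hastep
  have hapos : ∀ n ≤ T, 0 < a n := fun n hn => by linarith [(hgrowth n hn).1]
  have hxX' : ∀ n ≤ T, x (n + 1) ∈ X := fun n hn =>
    hxX _ (Finset.mem_Icc.2 ⟨by omega, by omega⟩)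
  have hxmin' : ∀ n ≤ T, ∀ y ∈ X,
      ⟪x (n + 1), M (n + 1) + ∑ s ∈ Finset.Icc 1 n, g s⟫ + a n / D ^ 2 * ‖x (n + 1)‖ ^ 2 ≤
        ⟪y, M (n + 1) + ∑ s ∈ Finset.Icc 1 n, g s⟫ + a n / D ^ 2 * ‖y‖ ^ 2 := by
    intro n hn y hy
    have h := hxmin (n + 1) (Finset.mem_Icc.2 ⟨by omega, by omega⟩) y hy
    rw [hηa n hn] at h
    simpa [div_div_eq_mul_div, mul_div_assoc, mul_comm, mul_div_right_comm] using h
  have hpotential : ∀ n ≤ T, ∑ t ∈ Finset.Icc 1 n, ⟪g t, x t⟫ ≤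
      ⟪x (n + 1), ∑ s ∈ Finset.Icc 1 n, g s⟫ + a n / D ^ 2 * ‖x (n + 1)‖ ^ 2
        + (a n - ν) / 4 := by
    intro n
    induction n with
    | zero =>
      intro hn
      have := hapos 0 hn
      have h : 0 ≤ a 0 / D ^ 2 * ‖x (0 + 1)‖ ^ 2 := by positivity
      rw [ha0] at *
      simpa using h
    | succ n ih =>
      intro hn
      have hprev := ih (by omega)
      have han := hapos n (by omega)
      have hgrow := quadratic_growth_of_minimizer hXconv (hxX' n (by omega))
        (hxX' (n + 1) hn) (hxmin' n (by omega))
      have hyoung := real_inner_le_weighted_sq (s := a n / D ^ 2) (by positivity)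
        (g (n + 1) - M (n + 1)) (x (n + 1) - x (n + 1 + 1))
      rw [norm_sub_rev (x (n + 1)), inv_div] at hyoung
      have hinc : a (n + 1) = a n + D ^ 2 / a n * ‖g (n + 1) - M (n + 1)‖ ^ 2 := by
        rw [hastep n hn]
        ring
      have hmono : a n / D ^ 2 * ‖x (n + 1 + 1)‖ ^ 2
          ≤ a (n + 1) / D ^ 2 * ‖x (n + 1 + 1)‖ ^ 2 := by
        have : a n ≤ a (n + 1) := by
          rw [hinc]
          exact le_add_of_nonneg_right (by positivity)
        gcongr
      rw [Finset.sum_Icc_succ_top (by omega), Finset.sum_Icc_succ_top (by omega)]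
      simp only [inner_add_right, inner_sub_left, inner_sub_right] at hgrow hyoung ⊢
      rw [real_inner_comm (x (n + 1)) (g (n + 1)), real_inner_comm (x (n + 1 + 1)) (g (n + 1)),
        real_inner_comm (x (n + 1)) (M (n + 1)),
        real_inner_comm (x (n + 1 + 1)) (M (n + 1))] at hyoung
      rw [real_inner_comm (x (n + 1)) (g (n + 1))]
      linarith
  have hfinal := hpotential T le_rfl
  have hu' := hxmin' T le_rfl u hu
  rw [hMT, zero_add] at hu'
  have haT := hapos T le_rfl
  have huD : a T / D ^ 2 * ‖u‖ ^ 2 ≤ a T := by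
    calc a T / D ^ 2 * ‖u‖ ^ 2 ≤ a T / D ^ 2 * D ^ 2 := by
          have := hXbdd u hu
          gcongr
      _ = a T := by field_simp
  have hregret : ∑ t ∈ Finset.Icc 1 T, ⟪g t, x t - u⟫
      = ∑ t ∈ Finset.Icc 1 T, ⟪g t, x t⟫ - ⟪u, ∑ s ∈ Finset.Icc 1 T, g s⟫ := by
    simp only [inner_sub_right, Finset.sum_sub_distrib, inner_sum, real_inner_comm u]
  have haT_le : a T ≤ 2 * (D * G) + 2 * (√2 * (D * G) * √T) := by
    have h2 : √2 ^ 2 = (2 : ℝ) := Real.sq_sqrt (by norm_num)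
    have hT2 : √(T : ℝ) ^ 2 = T := Real.sq_sqrt (Nat.cast_nonneg T)
    have hr : 0 ≤ √2 * (D * G) * √(T : ℝ) := by positivity
    have hr2 : (√2 * (D * G) * √(T : ℝ)) ^ 2 = 2 * (D * G) ^ 2 * T := by
      rw [mul_pow, mul_pow, h2, hT2]
    have h := (hgrowth T le_rfl).2
    have := abs_le_of_sq_le_sq' (a := a T - D * G)
      (b := D * G + 2 * (√2 * (D * G) * √(T : ℝ))) (by nlinarith) (by positivity)
    linarith [this.2]
  have hr : 0 ≤ √2 * (D * G) * √(T : ℝ) := by positivity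
  have hgoal : 3 * √2 * D * G * √(T : ℝ) = 3 * (√2 * (D * G) * √(T : ℝ)) := by ring
  rw [hregret, hgoal]
  linarith
end

section
/- The adaptive Optimistic FTRL iterates satisfy, for every u ∈ X, the deterministic bound Σ_{t=1}^T ⟨g_t, x_t − u⟩ ≤ (3√2·D/2)·√( Σ_{t=1}^T ‖g_t − M_t‖² ) + ν + 4D²G²/ν − (ν/(2D²))·Σ_{t=1}^T ‖x_{t+1} − x_t‖². -/
open Finset RealInnerProductSpace

theorem sum_Icc_one_eq_sum_range {F : Type*} [AddCommMonoid F] (f : ℕ → F) (n : ℕ) :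
    ∑ t ∈ Icc 1 n, f t = ∑ i ∈ range n, f (i + 1) := by
  rw [range_eq_Ico, sum_Ico_add' f 0 n 1]
  rfl

/-- A minimizer over a convex set of a linear function plus `ρ‖·‖²` satisfies a quadratic growth
inequality. -/
theorem quadratic_growth_of_isMin {E : Type*} [NormedAddCommGroup E] [InnerProductSpace ℝ E]
    {X : Set E} (hX : Convex ℝ X) {ρ : ℝ} {v x y : E} (hx : x ∈ X) (hy : y ∈ X)
    (hmin : ∀ z ∈ X, ⟪x, v⟫ + ρ * ‖x‖ ^ 2 ≤ ⟪z, v⟫ + ρ * ‖z‖ ^ 2) :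
    ⟪x, v⟫ + ρ * ‖x‖ ^ 2 + ρ * ‖y - x‖ ^ 2 ≤ ⟪y, v⟫ + ρ * ‖y‖ ^ 2 := by
  have key : ∀ l : ℝ, 0 < l → l ≤ 1 →
      (1 - l) * (ρ * ‖y - x‖ ^ 2) ≤
        (⟪y, v⟫ + ρ * ‖y‖ ^ 2) - (⟪x, v⟫ + ρ * ‖x‖ ^ 2) := by
    intro l hl hl1
    have h := hmin ((1 - l) • x + l • y) (hX hx hy (by linarith) hl.le (by ring))
    have hn : ‖(1 - l) • x + l • y‖ ^ 2 =
        (1 - l) * ‖x‖ ^ 2 + l * ‖y‖ ^ 2 - l * (1 - l) * ‖y - x‖ ^ 2 := by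
      rw [norm_add_sq_real, norm_sub_sq_real, norm_smul, norm_smul, real_inner_smul_left,
        real_inner_smul_right, real_inner_comm x y, mul_pow, mul_pow, Real.norm_eq_abs,
        Real.norm_eq_abs, sq_abs, sq_abs]
      ring
    rw [hn, inner_add_left, real_inner_smul_left, real_inner_smul_left] at h
    refine le_of_mul_le_mul_left ?_ hl
    linarith
  by_contra! hlt
  set N := ρ * ‖y - x‖ ^ 2
  set A := (⟪y, v⟫ + ρ * ‖y‖ ^ 2) - (⟪x, v⟫ + ρ * ‖x‖ ^ 2) with hA
  have hA0 : 0 ≤ A := by simpa using key 1 one_pos le_rfl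
  have hgap : 0 < N - A := by linarith
  have hN : 0 < N := by linarith
  have h := key ((N - A) / (2 * N)) (by positivity) (by
    rw [div_le_one (by positivity)]; linarith)
  have : (1 - (N - A) / (2 * N)) * N = N - (N - A) / 2 := by field_simp
  linarith

/-- One-step inequality with the potential `√(P² + 2δ²)`. -/
theorem step_le_sqrt_sub {P δ d : ℝ} (hP : 0 < P) (hδ : 0 ≤ δ) (hd : d ≤ 2) :
    P * δ ^ 2 / (P ^ 2 + δ ^ 2) + δ * d - P * d ^ 2 / 2 ≤
      3 / 2 * (√(P ^ 2 + 2 * δ ^ 2) - P) := by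
  set R := √(P ^ 2 + 2 * δ ^ 2)
  have hR : R ^ 2 = P ^ 2 + 2 * δ ^ 2 := Real.sq_sqrt (by positivity)
  have hR0 : 0 ≤ R := Real.sqrt_nonneg _
  have hPR : P ≤ R := abs_le_of_sq_le_sq' (by nlinarith) hR0 |>.2
  rcases le_total R (3 * P) with h3 | h3
  · have h1 : δ * d - P * d ^ 2 / 2 ≤ δ ^ 2 / (2 * P) := by
      rw [le_div_iff₀ (by positivity)]
      nlinarith [sq_nonneg (δ - P * d)]
    have h2 : P * δ ^ 2 / (P ^ 2 + δ ^ 2) + δ ^ 2 / (2 * P) ≤ 3 / 2 * (R - P) := by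
      have e : δ ^ 2 = (R ^ 2 - P ^ 2) / 2 := by linarith
      rw [div_add_div _ _ (by positivity) (by positivity), div_le_iff₀ (by positivity), e]
      have : 0 ≤ (R - P) ^ 2 * (4 * P * R - P ^ 2 - R ^ 2) :=
        mul_nonneg (sq_nonneg _) (by nlinarith)
      nlinarith
    linarith
  · have hδP : 2 * P ≤ δ := abs_le_of_sq_le_sq' (by nlinarith) hδ |>.2
    have h1 : δ * d - P * d ^ 2 / 2 ≤ 2 * δ - 2 * P := by
      nlinarith [mul_nonneg (sub_nonneg.2 hd) (sub_nonneg.2 hδP),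
        mul_nonneg (sub_nonneg.2 hd) (mul_nonneg hP.le (sub_nonneg.2 hd))]
    have h2 : P * δ ^ 2 / (P ^ 2 + δ ^ 2) ≤ P := by
      rw [div_le_iff₀ (by positivity)]
      nlinarith [pow_pos hP 3]
    have h3 : 2 * δ ≤ 3 / 2 * R - P / 2 :=
      abs_le_of_sq_le_sq' (by nlinarith [sq_nonneg (R - 3 * P)]) (by linarith) |>.2
    linarith

/-- Increments of the square root decrease with the base point. -/
theorem sqrt_add_sub_le {P q c : ℝ} (hP : 0 < P) (hq : 0 ≤ q) (hqP : q ≤ P ^ 2) (hc : 0 ≤ c) :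
    √(P ^ 2 + c) - P ≤ √(q + c) - √q := by
  have h1 := Real.sq_sqrt (show 0 ≤ P ^ 2 + c by positivity)
  have h2 := Real.sq_sqrt (show 0 ≤ q + c by positivity)
  have h3 := Real.sq_sqrt hq
  have h4 : √q ≤ P := Real.sqrt_le_iff.2 ⟨hP.le, hqP⟩
  have h5 : √(q + c) ≤ √(P ^ 2 + c) := Real.sqrt_le_sqrt (by linarith)
  have h6 : √q ≤ √(q + c) := Real.sqrt_le_sqrt (by linarith)
  have h7 := Real.sqrt_nonneg q
  by_contra! h
  nlinarith [mul_nonneg (sub_nonneg.2 h6) (add_nonneg (sub_nonneg.2 h4) (sub_nonneg.2 h5))]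

/-- Self-bounding estimate for the recursion `p (n + 1) = p n + e n ^ 2 / p n`. -/
theorem adaptive_sum_le {ν K : ℝ} (hν : 0 < ν) (T : ℕ) {p e d : ℕ → ℝ} (hp0 : p 0 = ν)
    (hp : ∀ n < T, p (n + 1) = p n + e n ^ 2 / p n)
    (he : ∀ n < T, 0 ≤ e n) (heK : ∀ n < T, e n ^ 2 ≤ K)
    (hd : ∀ n < T, d n ≤ 2) (n : ℕ) (hn : n ≤ T) :
    ν ≤ p n ∧ 2 * ∑ i ∈ range n, e i ^ 2 ≤ p n ^ 2 ∧
      p n - ν + ∑ i ∈ range n, (e i * d i - p i * d i ^ 2 / 2) ≤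
        3 / 2 * √(2 * ∑ i ∈ range n, e i ^ 2) + K * (1 / ν - 1 / p n) := by
  induction n with
  | zero => simp [hp0, sq_nonneg]
  | succ n ih =>
    obtain ⟨h1, h2, h3⟩ := ih (by omega)
    have hn' : n < T := hn
    have hP : 0 < p n := hν.trans_le h1
    have hpn := hp n hn'
    have ha : 0 ≤ e n ^ 2 / p n := by positivity
    have hP' : 0 < p (n + 1) := by linarith
    have hmul : e n ^ 2 / p n * p n = e n ^ 2 := by field_simp
    refine ⟨by linarith, ?_, ?_⟩
    · rw [sum_range_succ, hpn]
      nlinarith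
    · have hstep := step_le_sqrt_sub hP (he n hn') (hd n hn')
      have hinc := sqrt_add_sub_le (c := 2 * e n ^ 2) hP
        (mul_nonneg zero_le_two (sum_nonneg fun i _ => sq_nonneg (e i))) h2 (by positivity)
      have hnext : p n * e n ^ 2 / (p n ^ 2 + e n ^ 2) = e n ^ 2 / p (n + 1) := by
        rw [hpn]; field_simp
      have hmono : e n ^ 2 * (1 / p n - 1 / p (n + 1)) ≤ K * (1 / p n - 1 / p (n + 1)) := by
        refine mul_le_mul_of_nonneg_right (heK n hn') (sub_nonneg.2 ?_)
        exact one_div_le_one_div_of_le hP (by linarith)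
      have hdiff : e n ^ 2 * (1 / p n - 1 / p (n + 1)) = e n ^ 2 / p n - e n ^ 2 / p (n + 1) := by
        ring
      rw [sum_range_succ, sum_range_succ, mul_add]
      rw [hnext] at hstep
      linarith

/-- Optimistic FTRL regret decomposition, for regularizers `ρ t * ‖·‖²` with `ρ` nondecreasing. -/
theorem optimistic_ftrl_sum_le {E : Type*} [NormedAddCommGroup E] [InnerProductSpace ℝ E]
    {X : Set E} (hX : Convex ℝ X) (T : ℕ) {g M x : ℕ → E} {ρ : ℕ → ℝ}
    (hρ : ∀ n ≤ T, 0 ≤ ρ n) (hρmono : ∀ n < T, ρ n ≤ ρ (n + 1))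
    (hxX : ∀ n ≤ T, x n ∈ X)
    (hmin : ∀ n ≤ T, ∀ y ∈ X, ⟪x n, M n + ∑ i ∈ range n, g i⟫ + ρ n * ‖x n‖ ^ 2 ≤
      ⟪y, M n + ∑ i ∈ range n, g i⟫ + ρ n * ‖y‖ ^ 2) (n : ℕ) (hn : n ≤ T) :
    ∑ i ∈ range n, ⟪g i, x i⟫ ≤
      ⟪x n, ∑ i ∈ range n, g i⟫ + ρ n * ‖x n‖ ^ 2 +
        ∑ i ∈ range n, (‖g i - M i‖ * ‖x (i + 1) - x i‖ - ρ i * ‖x (i + 1) - x i‖ ^ 2) := by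
  induction n with
  | zero => simpa using mul_nonneg (hρ 0 hn) (sq_nonneg _)
  | succ n ih =>
    have ih := ih (by omega)
    have hgrow := quadratic_growth_of_isMin hX (hxX n (by omega))
      (hxX (n + 1) hn) (hmin n (by omega))
    have hCS : ⟪g n - M n, x n - x (n + 1)⟫ ≤ ‖g n - M n‖ * ‖x (n + 1) - x n‖ := by
      rw [norm_sub_rev (x (n + 1))]
      exact real_inner_le_norm _ _
    have hm := mul_le_mul_of_nonneg_right (hρmono n hn) (sq_nonneg ‖x (n + 1)‖)
    simp only [sum_range_succ, inner_add_right, inner_sub_left, inner_sub_right] at *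
    rw [real_inner_comm (x n) (M n), real_inner_comm (x (n + 1)) (M n)] at *
    rw [real_inner_comm (g n) (x (n + 1))]
    linarith

/-- Adaptive Optimistic FTRL: deterministic regret bound with negative movement term. -/
theorem stmt_3 {E : Type*} [NormedAddCommGroup E] [InnerProductSpace ℝ E]
    (D G ν : ℝ) (hD : 0 < D) (hG : 0 < G) (hν : 0 < ν)
    (X : Set E) (hXne : X.Nonempty) (hXconv : Convex ℝ X)
    (hXbdd : ∀ x ∈ X, ‖x‖ ≤ D)
    (T : ℕ) (hT : 1 ≤ T)
    (g M : ℕ → E)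
    (hg : ∀ t ∈ Finset.Icc 1 T, ‖g t‖ ≤ G)
    (hMb : ∀ t ∈ Finset.Icc 1 T, ‖M t‖ ≤ G) (hMT : M (T + 1) = 0)
    (η : ℕ → ℝ)
    (hη : ∀ t ∈ Finset.Icc 1 (T + 1),
      η t = D ^ 2 / (ν + ∑ s ∈ Finset.Icc 1 (t - 1), η s * ‖g s - M s‖ ^ 2))
    (x : ℕ → E) (hxX : ∀ t ∈ Finset.Icc 1 (T + 1), x t ∈ X)
    (hxmin : ∀ t ∈ Finset.Icc 1 (T + 1), ∀ y ∈ X,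
      ⟪x t, M t + ∑ s ∈ Finset.Icc 1 (t - 1), g s⟫ + ‖x t‖ ^ 2 / η t ≤
        ⟪y, M t + ∑ s ∈ Finset.Icc 1 (t - 1), g s⟫ + ‖y‖ ^ 2 / η t)
    (u : E) (hu : u ∈ X) :
    ∑ t ∈ Finset.Icc 1 T, ⟪g t, x t - u⟫ ≤
      3 * Real.sqrt 2 * D / 2 *
          Real.sqrt (∑ t ∈ Finset.Icc 1 T, ‖g t - M t‖ ^ 2) +
        ν + 4 * D ^ 2 * G ^ 2 / ν -
        ν / (2 * D ^ 2) * ∑ t ∈ Finset.Icc 1 T, ‖x (t + 1) - x t‖ ^ 2 := by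
  have mem : ∀ n ≤ T, n + 1 ∈ Icc 1 (T + 1) := fun n hn => by simp; omega
  have mem' : ∀ n < T, n + 1 ∈ Icc 1 T := fun n hn => by simp; omega
  simp only [sum_Icc_one_eq_sum_range] at hη hxmin ⊢
  set p : ℕ → ℝ := fun n => ν + ∑ i ∈ range n, η (i + 1) * ‖g (i + 1) - M (i + 1)‖ ^ 2 with hpdef
  have hηp : ∀ n ≤ T, η (n + 1) = D ^ 2 / p n := fun n hn => by
    simpa using hη (n + 1) (mem n hn)
  have hnorm : ∀ n ≤ T, ‖x (n + 1)‖ ≤ D := fun n hn => hXbdd _ (hxX _ (mem n hn))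
  have hp : ∀ n < T, p (n + 1) = p n + (D * ‖g (n + 1) - M (n + 1)‖) ^ 2 / p n := by
    intro n hn
    have : p (n + 1) = p n + η (n + 1) * ‖g (n + 1) - M (n + 1)‖ ^ 2 := by
      simp only [hpdef, sum_range_succ, add_assoc]
    rw [this, hηp n hn.le]
    ring
  have hdev : ∀ n < T, ‖g (n + 1) - M (n + 1)‖ ≤ 2 * G := fun n hn =>
    (norm_sub_le _ _).trans (by linarith [hg _ (mem' n hn), hMb _ (mem' n hn)])
  have hmove : ∀ n < T, ‖x (n + 1 + 1) - x (n + 1)‖ ≤ 2 * D := fun n hn =>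
    (norm_sub_le _ _).trans (by linarith [hnorm n hn.le, hnorm (n + 1) hn])
  have hsum := adaptive_sum_le (K := 4 * D ^ 2 * G ^ 2) hν T (p := p)
    (e := fun n => D * ‖g (n + 1) - M (n + 1)‖)
    (d := fun n => ‖x (n + 1 + 1) - x (n + 1)‖ / D) (by simp [hpdef]) hp
    (fun n _ => by positivity)
    (fun n hn => by
      rw [show 4 * D ^ 2 * G ^ 2 = (D * (2 * G)) ^ 2 by ring]
      gcongr
      exact hdev n hn)
    (fun n hn => by
      rw [div_le_iff₀ hD]
      exact hmove n hn)
  have hpν : ∀ n ≤ T, ν ≤ p n := fun n hn => (hsum n hn).1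
  have hppos : ∀ n ≤ T, 0 < p n := fun n hn => hν.trans_le (hpν n hn)
  have hmin : ∀ n ≤ T, ∀ y ∈ X,
      ⟪x (n + 1), M (n + 1) + ∑ i ∈ range n, g (i + 1)⟫ + p n / D ^ 2 * ‖x (n + 1)‖ ^ 2 ≤
        ⟪y, M (n + 1) + ∑ i ∈ range n, g (i + 1)⟫ + p n / D ^ 2 * ‖y‖ ^ 2 := by
    intro n hn y hy
    have h := hxmin (n + 1) (mem n hn) y hy
    have e : ∀ z : ℝ, z / η (n + 1) = p n / D ^ 2 * z := fun z => by
      rw [hηp n hn, div_div_eq_mul_div]; ring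
    rwa [e, e, Nat.add_sub_cancel] at h
  have hreg := optimistic_ftrl_sum_le hXconv T (g := fun n => g (n + 1)) (M := fun n => M (n + 1))
    (x := fun n => x (n + 1)) (ρ := fun n => p n / D ^ 2)
    (fun n hn => div_nonneg (hppos n hn).le (sq_nonneg D))
    (fun n hn => by
      have := hppos n hn.le
      refine div_le_div_of_nonneg_right ?_ (sq_nonneg D)
      rw [hp n hn]
      exact le_add_of_nonneg_right (by positivity))
    (fun n hn => hxX _ (mem n hn)) hmin T le_rfl
  have hlast := hmin T le_rfl u hu
  rw [hMT, zero_add] at hlast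
  have huD : p T / D ^ 2 * ‖u‖ ^ 2 ≤ p T := by
    have := hppos T le_rfl
    calc p T / D ^ 2 * ‖u‖ ^ 2 ≤ p T / D ^ 2 * D ^ 2 := by
          gcongr
          exact hXbdd u hu
      _ = p T := by field_simp
  have hbound := (hsum T le_rfl).2.2
  have hsqrt : 3 / 2 * √(2 * ∑ i ∈ range T, (D * ‖g (i + 1) - M (i + 1)‖) ^ 2) =
      3 * √2 * D / 2 * √(∑ i ∈ range T, ‖g (i + 1) - M (i + 1)‖ ^ 2) := by
    simp only [mul_pow, ← mul_sum]
    rw [Real.sqrt_mul zero_le_two, Real.sqrt_mul (sq_nonneg D), Real.sqrt_sq hD.le]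
    ring
  have hK : 4 * D ^ 2 * G ^ 2 * (1 / ν - 1 / p T) ≤ 4 * D ^ 2 * G ^ 2 / ν := by
    have : 0 ≤ 4 * D ^ 2 * G ^ 2 * (1 / p T) := by
      have := hppos T le_rfl
      positivity
    rw [mul_sub, mul_one_div]
    linarith
  have hterms : ∑ i ∈ range T, (‖g (i + 1) - M (i + 1)‖ * ‖x (i + 1 + 1) - x (i + 1)‖ -
        p i / D ^ 2 * ‖x (i + 1 + 1) - x (i + 1)‖ ^ 2) ≤
      ∑ i ∈ range T, (D * ‖g (i + 1) - M (i + 1)‖ * (‖x (i + 1 + 1) - x (i + 1)‖ / D) -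
        p i * (‖x (i + 1 + 1) - x (i + 1)‖ / D) ^ 2 / 2) -
      ν / (2 * D ^ 2) * ∑ i ∈ range T, ‖x (i + 1 + 1) - x (i + 1)‖ ^ 2 := by
    rw [mul_sum, ← sum_sub_distrib]
    refine sum_le_sum fun i hi => ?_
    have hpi := hpν i (mem_range.1 hi).le
    have h : ν / (2 * D ^ 2) * ‖x (i + 1 + 1) - x (i + 1)‖ ^ 2 ≤
        p i / (2 * D ^ 2) * ‖x (i + 1 + 1) - x (i + 1)‖ ^ 2 := by gcongr
    have e1 : D * ‖g (i + 1) - M (i + 1)‖ * (‖x (i + 1 + 1) - x (i + 1)‖ / D) =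
        ‖g (i + 1) - M (i + 1)‖ * ‖x (i + 1 + 1) - x (i + 1)‖ := by field_simp
    have e2 : p i / D ^ 2 * ‖x (i + 1 + 1) - x (i + 1)‖ ^ 2 =
        p i * (‖x (i + 1 + 1) - x (i + 1)‖ / D) ^ 2 / 2 +
          p i / (2 * D ^ 2) * ‖x (i + 1 + 1) - x (i + 1)‖ ^ 2 := by
      field_simp
      ring
    linarith
  have hsplit : ∑ i ∈ range T, ⟪g (i + 1), x (i + 1) - u⟫ =
      ∑ i ∈ range T, ⟪g (i + 1), x (i + 1)⟫ - ⟪u, ∑ i ∈ range T, g (i + 1)⟫ := by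
    rw [real_inner_comm, sum_inner, ← sum_sub_distrib]
    exact sum_congr rfl fun i _ => inner_sub_right _ _ _
  rw [hsplit]
  linarith
end

section
/- Assume in addition that the predictions are M_1 = 0 and M_t = g_{t-1} for 2 ≤ t ≤ T, and let p_1,…,p_T : X → E be maps each of which is L-Lipschitz on X (L ≥ 0), i.e. ‖p_t(x) − p_t(y)‖ ≤ L·‖x − y‖ for all x, y ∈ X. Then for every u ∈ X, Σ_{t=1}^T ⟨g_t, x_t − u⟩ ≤ 6D·√( Σ_{t=1}^T ‖g_t − p_t(x_t)‖² ) + 3√2·D·√( Σ_{t=1}^{T−1} ‖p_{t+1}(x_t) − p_t(x_t)‖² ) + (3√2/2)·D·G + ν + 4D²G²/ν + 9L²D⁴/ν. -/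
open Finset RealInnerProductSpace

/-- Quadratic growth of a quadratically regularised linear function at its minimiser. -/
theorem inner_add_sq_norm_growth_of_isMin {E : Type*} [NormedAddCommGroup E]
    [InnerProductSpace ℝ E] {X : Set E} (hX : Convex ℝ X) {k : ℝ} (hk : 0 ≤ k) {c x : E}
    (hx : x ∈ X) (hmin : ∀ y ∈ X, ⟪x, c⟫ + ‖x‖ ^ 2 * k ≤ ⟪y, c⟫ + ‖y‖ ^ 2 * k)
    {y : E} (hy : y ∈ X) :
    ⟪x, c⟫ + ‖x‖ ^ 2 * k + ‖y - x‖ ^ 2 * k ≤ ⟪y, c⟫ + ‖y‖ ^ 2 * k := by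
  obtain ⟨v, rfl⟩ : ∃ v, y = x + v := ⟨y - x, by abel⟩
  have hexp (l : ℝ) : ‖x + l • v‖ ^ 2 = ‖x‖ ^ 2 + 2 * l * ⟪x, v⟫ + l ^ 2 * ‖v‖ ^ 2 := by
    rw [norm_add_sq_real, inner_smul_right, norm_smul, mul_pow, Real.norm_eq_abs, sq_abs]
    ring
  have hsq := hexp 1
  rw [one_smul] at hsq
  have hseg (l : ℝ) (hl₀ : 0 < l) (hl₁ : l ≤ 1) :
      0 ≤ (⟪v, c⟫ + 2 * ⟪x, v⟫ * k) + l * (‖v‖ ^ 2 * k) := by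
    have h := hmin _ (hX.add_smul_mem hx hy ⟨hl₀.le, hl₁⟩)
    rw [hexp, inner_add_left, real_inner_smul_left] at h
    refine (mul_nonneg_iff_of_pos_left hl₀).1 ?_
    linarith
  have hdir : 0 ≤ ⟪v, c⟫ + 2 * ⟪x, v⟫ * k := by
    by_contra! hneg
    set a := ⟪v, c⟫ + 2 * ⟪x, v⟫ * k
    have hb : 0 ≤ ‖v‖ ^ 2 * k := by positivity
    set b := ‖v‖ ^ 2 * k
    have hba : 0 < b - a := by linarith
    have h := hseg (-a / (b - a)) (div_pos (by linarith) hba)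
      ((div_le_one hba).2 (by linarith))
    have heq : a + -a / (b - a) * b = -(a ^ 2 / (b - a)) := by field_simp; ring
    have : 0 < a ^ 2 / (b - a) := div_pos (by nlinarith) hba
    linarith
  rw [add_sub_cancel_left, hsq, inner_add_left]
  linarith

theorem mul_sub_sq_add_div_le_sqrt_sub {B r d w : ℝ} (hB : 0 < B) (hr : 0 ≤ r) (hd : d ≤ 2)
    (hwB : w ≤ B) :
    r * d - d ^ 2 * B / 2 + r ^ 2 * B / (B ^ 2 + r ^ 2) ≤
      3 / 2 * (√(w ^ 2 + 2 * r ^ 2) - w) := by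
  have hmono : √(B ^ 2 + 2 * r ^ 2) - B ≤ √(w ^ 2 + 2 * r ^ 2) - w := by
    have h₁ : √(B ^ 2 + 2 * r ^ 2) ≤ √(w ^ 2 + 2 * r ^ 2) + (B - w) := by
      rw [Real.sqrt_le_left (by positivity [sub_nonneg.2 hwB])]
      have hs := Real.sq_sqrt (show 0 ≤ w ^ 2 + 2 * r ^ 2 by positivity)
      have hsw : w ≤ √(w ^ 2 + 2 * r ^ 2) := Real.le_sqrt_of_sq_le (by nlinarith)
      nlinarith [mul_nonneg (sub_nonneg.2 hsw) (sub_nonneg.2 hwB)]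
    linarith
  refine le_trans ?_ (mul_le_mul_of_nonneg_left hmono (by norm_num))
  have key {Y : ℝ} (h : 3 * B * Y + Y ^ 2 ≤ 9 / 2 * r ^ 2) :
      Y ≤ 3 / 2 * (√(B ^ 2 + 2 * r ^ 2) - B) := by
    have : 2 / 3 * Y + B ≤ √(B ^ 2 + 2 * r ^ 2) := Real.le_sqrt_of_sq_le (by nlinarith)
    linarith
  rcases le_total r (2 * B) with h | h
  · have hY : r * d - d ^ 2 * B / 2 ≤ r ^ 2 / (2 * B) := by
      rw [le_div_iff₀ (by positivity)]
      nlinarith [sq_nonneg (r - d * B)]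
    refine le_trans (add_le_add_left hY _) (key ?_)
    have hz : r ^ 2 ≤ 4 * B ^ 2 := by nlinarith
    have heq : 9 / 2 * r ^ 2 - (3 * B * (r ^ 2 / (2 * B) + r ^ 2 * B / (B ^ 2 + r ^ 2)) +
        (r ^ 2 / (2 * B) + r ^ 2 * B / (B ^ 2 + r ^ 2)) ^ 2) =
        r ^ 4 * (3 * B ^ 4 + 6 * B ^ 2 * r ^ 2 - r ^ 4) /
          (4 * B ^ 2 * (B ^ 2 + r ^ 2) ^ 2) := by
      field_simp
      ring
    have : 0 ≤ 3 * B ^ 4 + 6 * B ^ 2 * r ^ 2 - r ^ 4 := by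
      nlinarith [mul_nonneg (sq_nonneg r) (sub_nonneg.2 hz), sq_nonneg (B ^ 2),
        mul_nonneg (sq_nonneg r) (sq_nonneg B)]
    rw [← sub_nonneg, heq]
    positivity
  · have hY : r * d - d ^ 2 * B / 2 ≤ 2 * r - 2 * B := by
      nlinarith [mul_nonneg (sub_nonneg.2 hd) (sub_nonneg.2 h),
        mul_nonneg (mul_nonneg (sub_nonneg.2 hd) (sub_nonneg.2 hd)) hB.le]
    have hY' : r ^ 2 * B / (B ^ 2 + r ^ 2) ≤ B := by
      rw [div_le_iff₀ (by positivity)]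
      nlinarith [pow_pos hB 3]
    refine le_trans (add_le_add hY hY') (key ?_)
    nlinarith [sq_nonneg (r - 2 * B)]

theorem sum_mul_sub_sq_add_le_sqrt {T : ℕ} {ν R : ℝ} (hν : 0 < ν) {B r d : ℕ → ℝ}
    (hB₀ : B 0 = ν) (hBpos : ∀ k ≤ T, 0 < B k)
    (hB : ∀ k < T, B (k + 1) = B k + r (k + 1) ^ 2 / B k)
    (hr : ∀ t ∈ Icc 1 T, 0 ≤ r t ∧ r t ≤ R) (hd : ∀ t ∈ Icc 1 T, d t ≤ 2) :
    (∑ t ∈ Icc 1 T, (r t * d t - d t ^ 2 * B (t - 1) / 2)) + B T ≤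
      ν + 3 / 2 * √(2 * ∑ t ∈ Icc 1 T, r t ^ 2) + R ^ 2 / ν := by
  have main (k : ℕ) (hk : k ≤ T) :
      2 * ∑ t ∈ Icc 1 k, r t ^ 2 ≤ B k ^ 2 ∧
      (∑ t ∈ Icc 1 k, (r t * d t - d t ^ 2 * B (t - 1) / 2)) + B k ≤
        ν + 3 / 2 * √(2 * ∑ t ∈ Icc 1 k, r t ^ 2) + R ^ 2 * (1 / ν - 1 / B k) := by
    induction k with
    | zero => simp [hB₀]; positivity
    | succ k ih =>
      obtain ⟨ih₁, ih₂⟩ := ih (by omega)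
      have hBk := hBpos k (by omega)
      have hBk' := hBpos (k + 1) hk
      have hstep := hB k (by omega)
      obtain ⟨hr₀, hrR⟩ := hr (k + 1) (by simp; omega)
      have hd' := hd (k + 1) (by simp; omega)
      rw [sum_Icc_succ_top (by omega), sum_Icc_succ_top (by omega), Nat.add_sub_cancel]
      set Q := ∑ t ∈ Icc 1 k, r t ^ 2
      have hQ : 0 ≤ Q := sum_nonneg fun _ _ => sq_nonneg _
      have hw : √(2 * Q) ≤ B k := (Real.sqrt_le_left hBk.le).2 ih₁
      have h := mul_sub_sq_add_div_le_sqrt_sub hBk hr₀ hd' hw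
      rw [Real.sq_sqrt (by positivity), ← mul_add] at h
      constructor
      · have hcross : B k * (r (k + 1) ^ 2 / B k) = r (k + 1) ^ 2 := by field_simp
        rw [hstep]
        nlinarith [sq_nonneg (r (k + 1) ^ 2 / B k)]
      · have hsplit : r (k + 1) ^ 2 / B k = r (k + 1) ^ 2 * B k / (B k ^ 2 + r (k + 1) ^ 2) +
            r (k + 1) ^ 2 * (1 / B k - 1 / B (k + 1)) := by
          have : B (k + 1) = (B k ^ 2 + r (k + 1) ^ 2) / B k := by rw [hstep]; field_simp
          rw [this]
          have : 0 < B k ^ 2 + r (k + 1) ^ 2 := by positivity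
          field_simp
          ring
        have hinv : 1 / B (k + 1) ≤ 1 / B k :=
          one_div_le_one_div_of_le hBk (hstep ▸ le_add_of_nonneg_right (by positivity))
        have hR : r (k + 1) ^ 2 * (1 / B k - 1 / B (k + 1)) ≤
            R ^ 2 * (1 / B k - 1 / B (k + 1)) :=
          mul_le_mul_of_nonneg_right (pow_le_pow_left₀ hr₀ hrR 2) (sub_nonneg.2 hinv)
        linarith
  have h := (main T le_rfl).2
  have hBT := hBpos T le_rfl
  have : 0 ≤ R ^ 2 * (1 / B T) := by positivity
  rw [div_eq_mul_one_div (R ^ 2) ν]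
  linarith

/-- Regret bound for optimistic FTRL with regularisers `k t * ‖·‖ ^ 2`, `k` nondecreasing. -/
theorem optimisticFTRL_regret_le {E : Type*} [NormedAddCommGroup E] [InnerProductSpace ℝ E]
    {X : Set E} (hX : Convex ℝ X) {T : ℕ} {g M x : ℕ → E} {k : ℕ → ℝ}
    (hk₀ : ∀ t ∈ Icc 1 (T + 1), 0 ≤ k t) (hk : ∀ t ∈ Icc 1 T, k t ≤ k (t + 1))
    (hMT : M (T + 1) = 0) (hx : ∀ t ∈ Icc 1 (T + 1), x t ∈ X)
    (hmin : ∀ t ∈ Icc 1 (T + 1), ∀ y ∈ X,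
      ⟪x t, M t + ∑ s ∈ Icc 1 (t - 1), g s⟫ + ‖x t‖ ^ 2 * k t ≤
        ⟪y, M t + ∑ s ∈ Icc 1 (t - 1), g s⟫ + ‖y‖ ^ 2 * k t)
    {u : E} (hu : u ∈ X) :
    ∑ t ∈ Icc 1 T, ⟪g t, x t - u⟫ ≤ ‖u‖ ^ 2 * k (T + 1) +
      ∑ t ∈ Icc 1 T, (‖g t - M t‖ * ‖x (t + 1) - x t‖ - ‖x (t + 1) - x t‖ ^ 2 * k t) := by
  have main (n : ℕ) (hn : n ≤ T) :
      ∑ t ∈ Icc 1 n, ⟪g t, x t⟫ ≤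
        ⟪x (n + 1), ∑ s ∈ Icc 1 n, g s⟫ + ‖x (n + 1)‖ ^ 2 * k (n + 1) +
        ∑ t ∈ Icc 1 n,
          (‖g t - M t‖ * ‖x (t + 1) - x t‖ - ‖x (t + 1) - x t‖ ^ 2 * k t) := by
    induction n with
    | zero =>
      have := hk₀ 1 (by simp)
      simp
      positivity
    | succ n ih =>
      have ih := ih (by omega)
      have hgrow := inner_add_sq_norm_growth_of_isMin hX (hk₀ (n + 1) (by simp; omega))
        (hx (n + 1) (by simp; omega)) (hmin (n + 1) (by simp; omega))
        (hx (n + 1 + 1) (by simp; omega))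
      have hreg := mul_le_mul_of_nonneg_left (hk (n + 1) (by simp; omega))
        (sq_nonneg ‖x (n + 1 + 1)‖)
      have hcs := real_inner_le_norm (x (n + 1) - x (n + 1 + 1)) (g (n + 1) - M (n + 1))
      rw [norm_sub_rev (x (n + 1))] at hcs
      simp only [inner_sub_left, inner_sub_right] at hcs
      simp only [sum_Icc_succ_top (show 1 ≤ n + 1 by omega), Nat.add_sub_cancel,
        inner_add_right] at hgrow ⊢
      rw [real_inner_comm (x (n + 1)) (g (n + 1))]
      linarith
  have h := main T le_rfl
  have hlast := hmin (T + 1) (by simp) u hu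
  simp only [hMT, zero_add, Nat.add_sub_cancel] at hlast
  simp only [inner_sub_right, sum_sub_distrib (fun t => ⟪g t, x t⟫)]
  rw [← sum_inner, real_inner_comm u]
  linarith

theorem norm_add_add_add_sq_le {E : Type*} [NormedAddCommGroup E] (a b c d : E) :
    ‖a + b + c + d‖ ^ 2 ≤ 4 * (‖a‖ ^ 2 + ‖b‖ ^ 2 + ‖c‖ ^ 2 + ‖d‖ ^ 2) := by
  have h : ‖a + b + c + d‖ ≤ ‖a‖ + ‖b‖ + ‖c‖ + ‖d‖ := norm_add₄_le
  have := pow_le_pow_left₀ (norm_nonneg _) h 2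
  nlinarith [sq_nonneg (‖a‖ - ‖b‖), sq_nonneg (‖a‖ - ‖c‖), sq_nonneg (‖a‖ - ‖d‖),
    sq_nonneg (‖b‖ - ‖c‖), sq_nonneg (‖b‖ - ‖d‖), sq_nonneg (‖c‖ - ‖d‖)]

/-- Gradient variation splits into noise, Lipschitz movement of the iterates and drift. -/
theorem sum_sq_norm_sub_le_of_lipschitz {E : Type*} [NormedAddCommGroup E] {X : Set E}
    {G L : ℝ} {T : ℕ} (hT : 1 ≤ T) {g M x : ℕ → E} {p : ℕ → E → E} (hg₁ : ‖g 1‖ ≤ G)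
    (hM1 : M 1 = 0) (hMg : ∀ t ∈ Icc 2 T, M t = g (t - 1)) (hx : ∀ t ∈ Icc 1 T, x t ∈ X)
    (hp : ∀ t ∈ Icc 1 T, ∀ a ∈ X, ∀ b ∈ X, ‖p t a - p t b‖ ≤ L * ‖a - b‖) :
    ∑ t ∈ Icc 1 T, ‖g t - M t‖ ^ 2 ≤ G ^ 2 +
      4 * (2 * ∑ t ∈ Icc 1 T, ‖g t - p t (x t)‖ ^ 2 +
        ∑ t ∈ Icc 1 (T - 1), ‖p (t + 1) (x t) - p t (x t)‖ ^ 2 +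
        L ^ 2 * ∑ t ∈ Icc 1 (T - 1), ‖x (t + 1) - x t‖ ^ 2) := by
  have main (n : ℕ) (hn : n + 1 ≤ T) :
      ∑ t ∈ Icc 1 (n + 1), ‖g t - M t‖ ^ 2 ≤ G ^ 2 +
        4 * (∑ t ∈ Icc 1 (n + 1), ‖g t - p t (x t)‖ ^ 2 +
          ∑ t ∈ Icc 1 n, ‖g t - p t (x t)‖ ^ 2 +
          ∑ t ∈ Icc 1 n, ‖p (t + 1) (x t) - p t (x t)‖ ^ 2 +
          L ^ 2 * ∑ t ∈ Icc 1 n, ‖x (t + 1) - x t‖ ^ 2) := by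
    induction n with
    | zero =>
      have := pow_le_pow_left₀ (norm_nonneg _) hg₁ 2
      simp [hM1]
      nlinarith [sq_nonneg ‖g 1 - p 1 (x 1)‖]
    | succ n ih =>
      have ih := ih (by omega)
      have hlip := pow_le_pow_left₀ (norm_nonneg _)
        (hp (n + 1 + 1) (by simp; omega) _ (hx (n + 1 + 1) (by simp; omega)) _
          (hx (n + 1) (by simp; omega))) 2
      rw [mul_pow] at hlip
      have h₄ := norm_add_add_add_sq_le (g (n + 1 + 1) - p (n + 1 + 1) (x (n + 1 + 1)))
        (p (n + 1 + 1) (x (n + 1 + 1)) - p (n + 1 + 1) (x (n + 1)))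
        (p (n + 1 + 1) (x (n + 1)) - p (n + 1) (x (n + 1))) (p (n + 1) (x (n + 1)) - g (n + 1))
      rw [sub_add_sub_cancel, sub_add_sub_cancel, sub_add_sub_cancel,
        norm_sub_rev (p (n + 1) (x (n + 1))) (g (n + 1))] at h₄
      rw [sum_Icc_succ_top (b := n + 1) (by omega), sum_Icc_succ_top (b := n + 1) (by omega),
        hMg (n + 1 + 1) (by simp; omega), Nat.add_sub_cancel]
      simp only [sum_Icc_succ_top (show 1 ≤ n + 1 by omega)] at ih ⊢
      linarith
  obtain ⟨n, rfl⟩ : ∃ n, T = n + 1 := ⟨T - 1, by omega⟩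
  have h := main n le_rfl
  rw [Nat.add_sub_cancel]
  rw [sum_Icc_succ_top (show 1 ≤ n + 1 by omega) (fun t => ‖g t - p t (x t)‖ ^ 2)] at h ⊢
  linarith [sq_nonneg ‖g (n + 1) - p (n + 1) (x (n + 1))‖]

/-- Adaptive Optimistic FTRL with `M_t = g_{t-1}` and `L`-Lipschitz mean-gradient maps. -/
theorem stmt_4 {E : Type*} [NormedAddCommGroup E] [InnerProductSpace ℝ E]
    (D G ν : ℝ) (hD : 0 < D) (hG : 0 < G) (hν : 0 < ν)
    (X : Set E) (hXne : X.Nonempty) (hXconv : Convex ℝ X)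
    (hXbdd : ∀ x ∈ X, ‖x‖ ≤ D)
    (T : ℕ) (hT : 1 ≤ T)
    (g M : ℕ → E)
    (hg : ∀ t ∈ Finset.Icc 1 T, ‖g t‖ ≤ G)
    (hMb : ∀ t ∈ Finset.Icc 1 T, ‖M t‖ ≤ G) (hMT : M (T + 1) = 0)
    (η : ℕ → ℝ)
    (hη : ∀ t ∈ Finset.Icc 1 (T + 1),
      η t = D ^ 2 / (ν + ∑ s ∈ Finset.Icc 1 (t - 1), η s * ‖g s - M s‖ ^ 2))
    (x : ℕ → E) (hxX : ∀ t ∈ Finset.Icc 1 (T + 1), x t ∈ X)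
    (hxmin : ∀ t ∈ Finset.Icc 1 (T + 1), ∀ y ∈ X,
      ⟪x t, M t + ∑ s ∈ Finset.Icc 1 (t - 1), g s⟫ + ‖x t‖ ^ 2 / η t ≤
        ⟪y, M t + ∑ s ∈ Finset.Icc 1 (t - 1), g s⟫ + ‖y‖ ^ 2 / η t)
    (hM1 : M 1 = 0) (hMg : ∀ t ∈ Finset.Icc 2 T, M t = g (t - 1))
    (L : ℝ) (hL : 0 ≤ L)
    (p : ℕ → E → E)
    (hp : ∀ t ∈ Finset.Icc 1 T, ∀ a ∈ X, ∀ b ∈ X, ‖p t a - p t b‖ ≤ L * ‖a - b‖)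
    (u : E) (hu : u ∈ X) :
    ∑ t ∈ Finset.Icc 1 T, ⟪g t, x t - u⟫ ≤
      6 * D * Real.sqrt (∑ t ∈ Finset.Icc 1 T, ‖g t - p t (x t)‖ ^ 2) +
        3 * Real.sqrt 2 * D *
          Real.sqrt (∑ t ∈ Finset.Icc 1 (T - 1), ‖p (t + 1) (x t) - p t (x t)‖ ^ 2) +
        3 * Real.sqrt 2 / 2 * D * G + ν + 4 * D ^ 2 * G ^ 2 / ν +
        9 * L ^ 2 * D ^ 4 / ν := by
  set B : ℕ → ℝ := fun n => ν + ∑ s ∈ Icc 1 n, η s * ‖g s - M s‖ ^ 2 with hBdef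
  have hηB (n : ℕ) (hn : n ≤ T) : η (n + 1) = D ^ 2 / B n := hη (n + 1) (by simp; omega)
  have hBsucc (n : ℕ) : B (n + 1) = B n + η (n + 1) * ‖g (n + 1) - M (n + 1)‖ ^ 2 := by
    simp only [hBdef]
    rw [sum_Icc_succ_top (by omega), add_assoc]
  have hBν (n : ℕ) (hn : n ≤ T) : ν ≤ B n := by
    induction n with
    | zero => simp [hBdef]
    | succ n ih =>
      have ih := ih (by omega)
      have : 0 < B n := hν.trans_le ih
      rw [hBsucc, hηB n (by omega)]
      have : 0 ≤ D ^ 2 / B n * ‖g (n + 1) - M (n + 1)‖ ^ 2 := by positivity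
      linarith
  have hBpos (n : ℕ) (hn : n ≤ T) : 0 < B n := hν.trans_le (hBν n hn)
  have hBstep (n : ℕ) (hn : n < T) :
      B (n + 1) = B n + (D * ‖g (n + 1) - M (n + 1)‖) ^ 2 / B n := by
    rw [hBsucc, hηB n (by omega)]
    ring
  have hdiv (a : ℝ) (t : ℕ) (ht : t ∈ Icc 1 (T + 1)) : a / η t = a * (B (t - 1) / D ^ 2) := by
    rw [mem_Icc] at ht
    obtain ⟨n, rfl⟩ : ∃ n, t = n + 1 := ⟨t - 1, by omega⟩
    rw [hηB n (by omega), Nat.add_sub_cancel]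
    have := hBpos n (by omega)
    field_simp
  have hregret := optimisticFTRL_regret_le (k := fun t => B (t - 1) / D ^ 2) hXconv
    (fun t ht => by
      have := hBpos (t - 1) (by simp at ht; omega)
      positivity)
    (fun t ht => by
      rw [mem_Icc] at ht
      obtain ⟨n, rfl⟩ : ∃ n, t = n + 1 := ⟨t - 1, by omega⟩
      simp only [Nat.add_sub_cancel]
      have := hBpos n (by omega)
      rw [hBstep n (by omega)]
      gcongr
      exact le_add_of_nonneg_right (by positivity))
    hMT hxX
    (fun t ht y hy => by
      rw [← hdiv _ t ht, ← hdiv _ t ht]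
      exact hxmin t ht y hy) hu
  have hΔ (t : ℕ) (ht : t ∈ Icc 1 T) : ‖x (t + 1) - x t‖ ≤ 2 * D := by
    rw [mem_Icc] at ht
    have := norm_sub_le (x (t + 1)) (x t)
    have := hXbdd _ (hxX (t + 1) (by simp; omega))
    have := hXbdd _ (hxX t (by simp; omega))
    linarith
  have hsum := sum_mul_sub_sq_add_le_sqrt (T := T) (R := 2 * D * G) hν
    (r := fun t => D * ‖g t - M t‖) (d := fun t => ‖x (t + 1) - x t‖ / D) (B := B)
    (by simp [hBdef]) hBpos hBstep
    (fun t ht => ⟨by positivity, by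
      have := norm_sub_le (g t) (M t)
      have := hg t ht
      have := hMb t ht
      calc D * ‖g t - M t‖ ≤ D * (2 * G) := by gcongr; linarith
        _ = 2 * D * G := by ring⟩)
    (fun t ht => (div_le_iff₀ hD).2 (hΔ t ht))
  have hvar := sum_sq_norm_sub_le_of_lipschitz hT (hg 1 (by simp; omega)) hM1 hMg
    (fun t ht => hxX t (by simp at ht ⊢; omega)) hp
  set σ := ∑ t ∈ Icc 1 T, ‖g t - p t (x t)‖ ^ 2
  set V := ∑ t ∈ Icc 1 (T - 1), ‖p (t + 1) (x t) - p t (x t)‖ ^ 2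
  set S := ∑ t ∈ Icc 1 (T - 1), ‖x (t + 1) - x t‖ ^ 2
  have hσ : 0 ≤ σ := sum_nonneg fun _ _ => sq_nonneg _
  have hV : 0 ≤ V := sum_nonneg fun _ _ => sq_nonneg _
  have hS : 0 ≤ S := sum_nonneg fun _ _ => sq_nonneg _
  have hmove : S * (ν / (2 * D ^ 2)) ≤
      ∑ t ∈ Icc 1 T, ‖x (t + 1) - x t‖ ^ 2 * (B (t - 1) / (2 * D ^ 2)) := by
    rw [sum_mul]
    calc _ ≤ ∑ t ∈ Icc 1 T, ‖x (t + 1) - x t‖ ^ 2 * (ν / (2 * D ^ 2)) :=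
          sum_le_sum_of_subset_of_nonneg (Icc_subset_Icc_right (by omega))
            fun _ _ _ => by positivity
      _ ≤ _ := by
          refine sum_le_sum fun t ht => ?_
          have := hBν (t - 1) (by simp at ht; omega)
          gcongr
  have hsplit : ∑ t ∈ Icc 1 T, (‖g t - M t‖ * ‖x (t + 1) - x t‖ -
        ‖x (t + 1) - x t‖ ^ 2 * (B (t - 1) / D ^ 2)) =
      (∑ t ∈ Icc 1 T, (D * ‖g t - M t‖ * (‖x (t + 1) - x t‖ / D) -
        (‖x (t + 1) - x t‖ / D) ^ 2 * B (t - 1) / 2)) -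
      ∑ t ∈ Icc 1 T, ‖x (t + 1) - x t‖ ^ 2 * (B (t - 1) / (2 * D ^ 2)) := by
    rw [← sum_sub_distrib]
    refine sum_congr rfl fun t _ => ?_
    field_simp
    ring
  have hu' : ‖u‖ ^ 2 * (B T / D ^ 2) ≤ B T := by
    have := hBpos T le_rfl
    calc ‖u‖ ^ 2 * (B T / D ^ 2) ≤ D ^ 2 * (B T / D ^ 2) := by
          gcongr
          exact hXbdd u hu
      _ = B T := by field_simp
  have hroot : √(2 * ∑ t ∈ Icc 1 T, (D * ‖g t - M t‖) ^ 2) ≤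
      √2 * D * (G + 2 * √2 * √σ + 2 * √V + 2 * L * √S) := by
    rw [Real.sqrt_le_left (by positivity)]
    simp only [mul_pow]
    rw [← mul_sum, Real.sq_sqrt zero_le_two, ← mul_assoc]
    refine mul_le_mul_of_nonneg_left (hvar.trans ?_) (by positivity)
    have h₁ : (2 * √2 * √σ) ^ 2 = 8 * σ := by
      rw [mul_pow, mul_pow, Real.sq_sqrt hσ, Real.sq_sqrt zero_le_two]; ring
    have h₂ : (2 * √V) ^ 2 = 4 * V := by rw [mul_pow, Real.sq_sqrt hV]; ring
    have h₃ : (2 * L * √S) ^ 2 = 4 * (L ^ 2 * S) := by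
      rw [mul_pow, mul_pow, Real.sq_sqrt hS]; ring
    have e₁ : 0 ≤ 2 * √2 * √σ := by positivity
    have e₂ : 0 ≤ 2 * √V := by positivity
    have e₃ : 0 ≤ 2 * L * √S := by positivity
    nlinarith [mul_nonneg e₁ e₂, mul_nonneg e₁ e₃, mul_nonneg e₂ e₃, mul_nonneg hG.le e₁,
      mul_nonneg hG.le e₂, mul_nonneg hG.le e₃]
  have hlip : 3 * √2 * D * L * √S ≤ 9 * L ^ 2 * D ^ 4 / ν + S * (ν / (2 * D ^ 2)) := by
    have h₂ : √2 ^ 2 = 2 := Real.sq_sqrt zero_le_two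
    have hSS : √S ^ 2 = S := Real.sq_sqrt hS
    have heq : 9 * L ^ 2 * D ^ 4 / ν + S * (ν / (2 * D ^ 2)) - 3 * √2 * D * L * √S =
        (3 * √2 * L * D ^ 3 - ν * √S) ^ 2 / (2 * D ^ 2 * ν) := by
      field_simp
      linear_combination (-9 * L ^ 2 * D ^ 6) * h₂ - ν ^ 2 * hSS
    have : 0 ≤ (3 * √2 * L * D ^ 3 - ν * √S) ^ 2 / (2 * D ^ 2 * ν) := by positivity
    linarith
  have hcoef : 3 / 2 * (√2 * D * (G + 2 * √2 * √σ + 2 * √V + 2 * L * √S)) =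
      3 * √2 / 2 * D * G + 6 * D * √σ + 3 * √2 * D * √V + 3 * √2 * D * L * √S := by
    linear_combination (3 * D * √σ) * Real.sq_sqrt (zero_le_two (α := ℝ))
  have hGν : (2 * D * G) ^ 2 / ν = 4 * D ^ 2 * G ^ 2 / ν := by ring
  simp only [Nat.add_sub_cancel] at hregret
  rw [hsplit] at hregret
  linarith
end

section
/- The adaptively weighted sums satisfy Σ_{t=1}^T η_t·a_t ≤ D·√( 2·Σ_{t=1}^T a_t ) + 4D²G²/ν. -/
open Finset

/-- The weighted sums `S` of the stepsize recursion are nonnegative and satisfy the quadratic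
inequality `S ^ 2 ≤ 2 * D ^ 2 * ∑ a + (4 * D ^ 2 * G ^ 2 / ν) * S`. -/
theorem sq_weighted_sum_le {D ν G : ℝ} (hν : 0 < ν) {T : ℕ} {a η : ℕ → ℝ}
    (ha : ∀ t ∈ Finset.Icc 1 T, 0 ≤ a t ∧ a t ≤ 4 * G ^ 2)
    (hη : ∀ t ∈ Finset.Icc 1 T,
      η t = D ^ 2 / (ν + ∑ s ∈ Finset.Icc 1 (t - 1), η s * a s)) :
    ∀ n ≤ T, 0 ≤ ∑ t ∈ Finset.Icc 1 n, η t * a t ∧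
      (∑ t ∈ Finset.Icc 1 n, η t * a t) ^ 2 ≤ 2 * D ^ 2 * ∑ t ∈ Finset.Icc 1 n, a t +
        4 * D ^ 2 * G ^ 2 / ν * ∑ t ∈ Finset.Icc 1 n, η t * a t := by
  intro n
  induction n with
  | zero => simp
  | succ n ih =>
    intro hn
    obtain ⟨hS, hsq⟩ := ih (by omega)
    have hmem : n + 1 ∈ Finset.Icc 1 T := by simp; omega
    obtain ⟨ha0, haG⟩ := ha _ hmem
    have hstep := hη _ hmem
    rw [Nat.add_sub_cancel] at hstep
    rw [Finset.sum_Icc_succ_top (by omega), Finset.sum_Icc_succ_top (by omega)]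
    set S := ∑ t ∈ Finset.Icc 1 n, η t * a t
    have hpos : 0 < ν + S := by positivity
    have hx0 : 0 ≤ η (n + 1) * a (n + 1) := by rw [hstep]; positivity
    have hxS : η (n + 1) * a (n + 1) * (ν + S) = D ^ 2 * a (n + 1) := by
      rw [hstep]; field_simp
    set x := η (n + 1) * a (n + 1)
    have hSx : 0 ≤ S * x := mul_nonneg hS hx0
    have hνx : 0 ≤ ν * x := mul_nonneg hν.le hx0
    have hDa : D ^ 2 * a (n + 1) ≤ D ^ 2 * (4 * G ^ 2) := by gcongr
    have hxM : x ≤ 4 * D ^ 2 * G ^ 2 / ν := by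
      rw [le_div_iff₀ hν]; linarith
    have hxx := mul_le_mul_of_nonneg_right hxM hx0
    exact ⟨by positivity, by linarith⟩

/-- The adaptively weighted sums of the AdaFTRL stepsize recursion. -/
theorem stmt_5 (D ν G : ℝ) (hD : 0 < D) (hν : 0 < ν) (hG : 0 ≤ G)
    (T : ℕ) (hT : 1 ≤ T)
    (a : ℕ → ℝ) (ha : ∀ t ∈ Finset.Icc 1 T, 0 ≤ a t ∧ a t ≤ 4 * G ^ 2)
    (η : ℕ → ℝ)
    (hη : ∀ t ∈ Finset.Icc 1 T,
      η t = D ^ 2 / (ν + ∑ s ∈ Finset.Icc 1 (t - 1), η s * a s)) :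
    ∑ t ∈ Finset.Icc 1 T, η t * a t ≤
      D * Real.sqrt (2 * ∑ t ∈ Finset.Icc 1 T, a t) + 4 * D ^ 2 * G ^ 2 / ν := by
  obtain ⟨hS, hsq⟩ := sq_weighted_sum_le hν ha hη T le_rfl
  have hA : 0 ≤ ∑ t ∈ Finset.Icc 1 T, a t := Finset.sum_nonneg fun t ht => (ha t ht).1
  have hM : 0 ≤ 4 * D ^ 2 * G ^ 2 / ν := by positivity
  set S := ∑ t ∈ Finset.Icc 1 T, η t * a t
  set M := 4 * D ^ 2 * G ^ 2 / ν
  rw [← sub_le_iff_le_add]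
  rcases le_total S M with h | h
  · exact (sub_nonpos.2 h).trans (by positivity)
  · refine abs_le_of_sq_le_sq' ?_ (by positivity) |>.2
    rw [mul_pow, Real.sq_sqrt (by positivity)]
    nlinarith [mul_nonneg hM (sub_nonneg.2 h)]
end

section
/- For every integer T ≥ 1 and all reals L ≥ 0 and μ > 0, Σ_{t=1}^T max( 0, 4L²/(μ·t) − μ·t/4 ) ≤ (4L²/μ)·log( 1 + 16·L/μ ), where log denotes the natural logarithm. -/
open Finset

/-- For `a ≥ 0`, the reciprocals of the positive integers up to `a` sum to at most `log (1 + 4 a)`. -/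
lemma sum_inv_Icc_floor_le_log {a : ℝ} (ha : 0 ≤ a) :
    ∑ t ∈ Finset.Icc 1 ⌊a⌋₊, (t : ℝ)⁻¹ ≤ Real.log (1 + 4 * a) := by
  rcases lt_or_ge a 1 with h | h
  · rw [Nat.floor_eq_zero.2 h]
    simpa using Real.log_nonneg (by linarith)
  · have hharm := harmonic_floor_le_one_add_log a h
    rw [harmonic_eq_sum_Icc] at hharm
    push_cast at hharm
    have ha0 : 0 < a := by linarith
    calc ∑ t ∈ Finset.Icc 1 ⌊a⌋₊, (t : ℝ)⁻¹ ≤ 1 + Real.log a := hharm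
      _ = Real.log (Real.exp 1 * a) := by
          rw [Real.log_mul (Real.exp_pos 1).ne' ha0.ne', Real.log_exp]
      _ ≤ Real.log (1 + 4 * a) := by
          refine Real.log_le_log (mul_pos (Real.exp_pos 1) ha0) ?_
          nlinarith [Real.exp_one_lt_d9]

/-- A summand is at most `4L²/(μt)`, and it vanishes as soon as `t > 4L/μ`. -/
lemma max_zero_sub_le_ite {L μ : ℝ} (hL : 0 ≤ L) (hμ : 0 < μ) {t : ℕ} (ht : 1 ≤ t) :
    max 0 (4 * L ^ 2 / (μ * (t : ℝ)) - μ * (t : ℝ) / 4) ≤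
      if t ≤ ⌊4 * L / μ⌋₊ then 4 * L ^ 2 / μ * (t : ℝ)⁻¹ else 0 := by
  have ht0 : (0 : ℝ) < t := by exact_mod_cast ht
  split_ifs with h
  · have heq : 4 * L ^ 2 / (μ * (t : ℝ)) = 4 * L ^ 2 / μ * (t : ℝ)⁻¹ := by
      field_simp
    rw [heq]
    refine max_le (by positivity) (sub_le_self _ (by positivity))
  · have hlt : 4 * L < t * μ := (div_lt_iff₀ hμ).1 (Nat.lt_of_floor_lt (not_le.1 h))
    refine max_le le_rfl (sub_nonpos.2 ?_)
    rw [div_le_iff₀ (by positivity)]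
    nlinarith

/-- Bound on the positive part of `Σ (4L²/(μt) − μt/4)`. -/
theorem stmt_7 (T : ℕ) (hT : 1 ≤ T) (L μ : ℝ) (hL : 0 ≤ L) (hμ : 0 < μ) :
    ∑ t ∈ Finset.Icc 1 T, max 0 (4 * L ^ 2 / (μ * (t : ℝ)) - μ * (t : ℝ) / 4) ≤
      4 * L ^ 2 / μ * Real.log (1 + 16 * L / μ) := by
  calc ∑ t ∈ Finset.Icc 1 T, max 0 (4 * L ^ 2 / (μ * (t : ℝ)) - μ * (t : ℝ) / 4)
      ≤ ∑ t ∈ Finset.Icc 1 T, if t ≤ ⌊4 * L / μ⌋₊ then 4 * L ^ 2 / μ * (t : ℝ)⁻¹ else 0 :=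
        Finset.sum_le_sum fun t ht => max_zero_sub_le_ite hL hμ (Finset.mem_Icc.1 ht).1
    _ ≤ ∑ t ∈ Finset.Icc 1 ⌊4 * L / μ⌋₊, 4 * L ^ 2 / μ * (t : ℝ)⁻¹ := by
        rw [← Finset.sum_filter]
        refine Finset.sum_le_sum_of_subset_of_nonneg (fun t ht => ?_) fun t _ _ => by positivity
        simp only [Finset.mem_filter, Finset.mem_Icc] at ht ⊢
        exact ⟨ht.1.1, ht.2⟩
    _ ≤ 4 * L ^ 2 / μ * Real.log (1 + 4 * (4 * L / μ)) := by
        rw [← Finset.mul_sum]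
        exact mul_le_mul_of_nonneg_left (sum_inv_Icc_floor_le_log (by positivity)) (by positivity)
    _ = 4 * L ^ 2 / μ * Real.log (1 + 16 * L / μ) := by ring_nf
end

section
/- Let v_1,…,v_T be vectors in a real inner product space with ‖v_i‖ ≤ G for all i, and let {1,…,T} = S_1 ⊋ S_2 ⊋ … ⊋ S_T be a decreasing chain of subsets with |S_t| = T − t + 1 for every t (so each S_t is obtained from S_{t-1} by removing one element). Writing μ_{S_t} = (1/|S_t|)·Σ_{i∈S_t} v_i, one has Σ_{t=2}^T ‖μ_{S_t} − μ_{S_{t-1}}‖² ≤ 8G². -/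
open Finset

/-- Adding one point to a nonempty finite family of vectors of norm at most `G` moves its mean by
at most `2 * G / (n + 1)`, where `n` is the size of the family. -/
lemma norm_mean_sub_mean_insert_le {ι E : Type*} [DecidableEq ι] [NormedAddCommGroup E]
    [NormedSpace ℝ E] {v : ι → E} {G : ℝ} (hG : ∀ i, ‖v i‖ ≤ G) {A : Finset ι} {a : ι}
    (ha : a ∉ A) (hA : A.Nonempty) :
    ‖(A.card : ℝ)⁻¹ • ∑ i ∈ A, v i -
        ((insert a A).card : ℝ)⁻¹ • ∑ i ∈ insert a A, v i‖ ≤ 2 * G / (A.card + 1) := by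
  have hn : (0 : ℝ) < A.card := by exact_mod_cast hA.card_pos
  rw [Finset.sum_insert ha, Finset.card_insert_of_notMem ha]
  push_cast
  have hdiff : (A.card : ℝ)⁻¹ • ∑ i ∈ A, v i - ((A.card : ℝ) + 1)⁻¹ • (v a + ∑ i ∈ A, v i) =
      ((A.card : ℝ) + 1)⁻¹ • ((A.card : ℝ)⁻¹ • ∑ i ∈ A, v i - v a) := by
    match_scalars
    · field_simp
      ring
    · ring
  have hsum : ‖∑ i ∈ A, v i‖ ≤ A.card * G := by
    simpa using norm_sum_le_of_le A (fun i _ => hG i)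
  have hmean : ‖(A.card : ℝ)⁻¹ • ∑ i ∈ A, v i‖ ≤ G := by
    rw [norm_smul, norm_inv, Real.norm_of_nonneg hn.le, inv_mul_le_iff₀ hn]
    exact hsum
  rw [hdiff, norm_smul, norm_inv, Real.norm_of_nonneg (by positivity), div_eq_inv_mul]
  gcongr
  linarith [norm_sub_le ((A.card : ℝ)⁻¹ • ∑ i ∈ A, v i) (v a), hG a]

lemma sum_Icc_two_sub_pred (f : ℕ → ℝ) {m : ℕ} (hm : 1 ≤ m) :
    ∑ t ∈ Finset.Icc 2 m, (f t - f (t - 1)) = f m - f 1 := by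
  induction m, hm using Nat.le_induction with
  | base => simp
  | succ k hk ih =>
    rw [Finset.sum_Icc_succ_top (by lia), ih, Nat.add_sub_cancel]
    ring

lemma sq_two_mul_div_succ_le (G : ℝ) {x : ℝ} (hx : 0 < x) :
    (2 * G / (x + 1)) ^ 2 ≤ 4 * G ^ 2 * (1 / x - 1 / (x + 1)) := by
  have h : (1 / (x + 1)) ^ 2 ≤ 1 / x - 1 / (x + 1) := by
    rw [div_sub_div _ _ hx.ne' (by positivity), div_pow, div_le_div_iff₀ (by positivity)
      (by positivity)]
    nlinarith
  calc (2 * G / (x + 1)) ^ 2 = 4 * G ^ 2 * (1 / (x + 1)) ^ 2 := by ring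
    _ ≤ _ := by gcongr

/-- Cumulative adversarial variation of the means along a decreasing chain of subsets. -/
theorem stmt_11 {E : Type*} [NormedAddCommGroup E] [InnerProductSpace ℝ E]
    (T : ℕ) (hT : 1 ≤ T) (v : Fin T → E) (G : ℝ) (hG : ∀ i, ‖v i‖ ≤ G)
    (S : ℕ → Finset (Fin T))
    (hS1 : S 1 = Finset.univ)
    (hSchain : ∀ t ∈ Finset.Icc 2 T, S t ⊂ S (t - 1))
    (hScard : ∀ t ∈ Finset.Icc 1 T, (S t).card = T - t + 1) :
    ∑ t ∈ Finset.Icc 2 T,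
        ‖((S t).card : ℝ)⁻¹ • ∑ i ∈ S t, v i -
            ((S (t - 1)).card : ℝ)⁻¹ • ∑ i ∈ S (t - 1), v i‖ ^ 2 ≤
      8 * G ^ 2 := by
  set f : ℕ → ℝ := fun t => 1 / ((T : ℝ) - t + 1) with hf
  have hterm : ∀ t ∈ Finset.Icc 2 T,
      ‖((S t).card : ℝ)⁻¹ • ∑ i ∈ S t, v i -
          ((S (t - 1)).card : ℝ)⁻¹ • ∑ i ∈ S (t - 1), v i‖ ^ 2 ≤
        4 * G ^ 2 * (f t - f (t - 1)) := by
    intro t ht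
    obtain ⟨h2, htT⟩ := Finset.mem_Icc.mp ht
    have hcard := hScard t (Finset.mem_Icc.mpr ⟨by lia, htT⟩)
    have hcard' := hScard (t - 1) (Finset.mem_Icc.mpr ⟨by lia, by lia⟩)
    obtain ⟨a, ha, hins⟩ :=
      Finset.exists_eq_insert_iff.mpr ⟨(hSchain t ht).subset, by lia⟩
    have hle := norm_mean_sub_mean_insert_le hG ha (Finset.card_pos.mp (by lia))
    have hx : ((S t).card : ℝ) = (T : ℝ) - t + 1 := by
      rw [hcard]; push_cast [Nat.cast_sub htT]; ring
    have hpos : (0 : ℝ) < (S t).card := by rw [hcard]; positivity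
    rw [hins] at hle
    have hft : f t = 1 / ((S t).card : ℝ) := by rw [hx]
    have hft' : f (t - 1) = 1 / (((S t).card : ℝ) + 1) := by
      rw [hx, hf]; push_cast [Nat.cast_sub (by lia : 1 ≤ t)]; ring
    rw [hft, hft']
    exact (pow_le_pow_left₀ (norm_nonneg _) hle 2).trans (sq_two_mul_div_succ_le G hpos)
  have hfT : f T = 1 := by simp [hf]
  have hf1 : 0 ≤ f 1 := by simp [hf]
  calc _ ≤ ∑ t ∈ Finset.Icc 2 T, 4 * G ^ 2 * (f t - f (t - 1)) := Finset.sum_le_sum hterm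
    _ = 4 * G ^ 2 * (f T - f 1) := by rw [← Finset.mul_sum, sum_Icc_two_sub_pred f hT]
    _ ≤ 8 * G ^ 2 := by rw [hfT]; nlinarith [sq_nonneg G, mul_nonneg (sq_nonneg G) hf1]
end

section
/- For every integer T ≥ 1 and all reals σ, σ̃ with 0 < σ ≤ σ̃, one has Σ_{t=1}^T min( T·σ²/(T − t + 1), σ̃² ) ≤ T·σ²·log( 2e²·σ̃²/σ² ), where log denotes the natural logarithm. -/
open Finset

/-- Comparison of `∑ min (1/k) (1/x)` with the integral of `s ↦ min (1/s) (1/x)`, on either side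
of the point `x` where the minimum switches. -/
theorem sum_min_inv_le_div_and_le_one_add_log {x : ℝ} (hx : 0 < x) (n : ℕ) :
    ((n : ℝ) ≤ x → ∑ k ∈ range n, min (1 / ((k : ℝ) + 1)) (1 / x) ≤ n / x) ∧
      (x ≤ n → ∑ k ∈ range n, min (1 / ((k : ℝ) + 1)) (1 / x) ≤ 1 + Real.log (n / x)) := by
  induction n with
  | zero => exact ⟨fun _ => by simp, fun h => absurd h (by simpa using hx)⟩
  | succ n ih =>
    have hm : (0 : ℝ) < n + 1 := by positivity
    rw [sum_range_succ]
    push_cast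
    refine ⟨fun h => ?_, fun h => ?_⟩
    · have := ih.1 (by linarith)
      rw [add_div]
      exact add_le_add this (min_le_right _ _)
    · have hmin := min_le_left (1 / ((n : ℝ) + 1)) (1 / x)
      rcases le_total x n with hxn | hxn
      · have hn : (0 : ℝ) < n := hx.trans_le hxn
        have hlog := Real.one_sub_inv_le_log_of_pos (div_pos hm hn)
        have hinv : 1 - (((n : ℝ) + 1) / n)⁻¹ = 1 / ((n : ℝ) + 1) := by
          field_simp
          ring
        have hsum := ih.2 hxn
        rw [Real.log_div hn.ne' hx.ne'] at hsum
        rw [Real.log_div hm.ne' hn.ne', hinv] at hlog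
        rw [Real.log_div hm.ne' hx.ne']
        linarith
      · have hlog := Real.one_sub_inv_le_log_of_pos (div_pos hm hx)
        have hsum := ih.1 hxn
        have hquad : (n : ℝ) / x + 1 / (n + 1) ≤ 2 - (((n : ℝ) + 1) / x)⁻¹ := by
          rw [← sub_nonneg]
          have : 2 - (((n : ℝ) + 1) / x)⁻¹ - (n / x + 1 / (n + 1)) =
              (n + 1 - x) * (x - n) / (x * (n + 1)) := by
            field_simp
            ring
          rw [this]
          exact div_nonneg (mul_nonneg (by linarith) (by linarith)) (by positivity)
        linarith

/-- Deterministic core of the ROM variance bound. -/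
theorem stmt_12 (T : ℕ) (hT : 1 ≤ T) (σ σ' : ℝ) (hσ : 0 < σ) (hσσ' : σ ≤ σ') :
    ∑ t ∈ Finset.Icc 1 T,
        min ((T : ℝ) * σ ^ 2 / ((T : ℝ) - (t : ℝ) + 1)) (σ' ^ 2) ≤
      (T : ℝ) * σ ^ 2 * Real.log (2 * Real.exp 2 * σ' ^ 2 / σ ^ 2) := by
  have hσ' : 0 < σ' := hσ.trans_le hσσ'
  have hT' : (0 : ℝ) < T := by exact_mod_cast hT
  have hc : 0 < (T : ℝ) * σ ^ 2 := by positivity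
  have hx : 0 < (T : ℝ) * σ ^ 2 / σ' ^ 2 := by positivity
  have hxT : (T : ℝ) * σ ^ 2 / σ' ^ 2 ≤ T := by
    rw [div_le_iff₀ (by positivity)]
    gcongr
  have hsum : ∑ t ∈ Finset.Icc 1 T,
        min ((T : ℝ) * σ ^ 2 / ((T : ℝ) - (t : ℝ) + 1)) (σ' ^ 2) =
      (T : ℝ) * σ ^ 2 *
        ∑ k ∈ range T, min (1 / ((k : ℝ) + 1)) (1 / ((T : ℝ) * σ ^ 2 / σ' ^ 2)) := by
    rw [mul_sum]
    refine sum_nbij' (fun t => T - t) (fun k => T - k) ?_ ?_ ?_ ?_ ?_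
    · intro t ht
      simp only [mem_Icc, mem_range] at ht ⊢
      omega
    · intro k hk
      simp only [mem_Icc, mem_range] at hk ⊢
      omega
    · intro t ht
      simp only [mem_Icc] at ht
      omega
    · intro k hk
      simp only [mem_range] at hk
      omega
    · intro t ht
      rw [Nat.cast_sub (mem_Icc.mp ht).2, mul_min_of_nonneg _ _ hc.le, mul_one_div, mul_one_div,
        div_div_cancel₀ hc.ne']
  have hlog : Real.log (2 * Real.exp 2 * σ' ^ 2 / σ ^ 2) =
      Real.log 2 + 2 + Real.log (T / ((T : ℝ) * σ ^ 2 / σ' ^ 2)) := by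
    have hratio : (T : ℝ) / ((T : ℝ) * σ ^ 2 / σ' ^ 2) = σ' ^ 2 / σ ^ 2 := by
      field_simp
    rw [hratio, mul_div_assoc, Real.log_mul (by positivity) (by positivity),
      Real.log_mul (by norm_num) (Real.exp_pos 2).ne', Real.log_exp]
  rw [hsum, hlog]
  have hbound := (sum_min_inv_le_div_and_le_one_add_log hx T).2 hxT
  have hlog2 : 0 < Real.log 2 := Real.log_pos (by norm_num)
  exact mul_le_mul_of_nonneg_left (by linarith) hc.le
end

section
/- Let X be a nonempty set, E a real normed space, G ≥ 0, and T ≥ 1 an integer. Let p_0, p_1, …, p_T : X → E satisfy ‖p_t(x)‖ ≤ G for all t ∈ {0,…,T} and all x ∈ X. Let h_0 ≡ 0 and h_1,…,h_T : X → E, and let c_1,…,c_T ≥ 0 satisfy ‖h_t(x)‖ ≤ c_t for all x ∈ X. Assume p_t(x) − p_{t-1}(x) = h_t(x) − h_{t-1}(x) for every t ∈ {1,…,T} and every x ∈ X. Then Σ_{t=1}^T sup_{x∈X} ‖p_t(x) − p_{t-1}(x)‖² ≤ 4G·Σ_{t=1}^T c_t. -/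
open Finset

/-- Two consecutive terms `d t + d (t - 1)`, summed over `t`, count every term twice except the two end ones. -/
lemma sum_Icc_add_pred_eq (d : ℕ → ℝ) (n : ℕ) :
    ∑ t ∈ Finset.Icc 1 n, (d t + d (t - 1)) = 2 * ∑ t ∈ Finset.Icc 1 n, d t + d 0 - d n := by
  induction n with
  | zero => simp
  | succ n ih =>
    rw [Finset.sum_Icc_succ_top (by omega), Finset.sum_Icc_succ_top (by omega), ih,
      Nat.add_sub_cancel]
    ring

/-- Cumulative adversarial variation bound in the adversarially corrupted model. -/
theorem stmt_15 {X : Type*} [Nonempty X] {E : Type*} [NormedAddCommGroup E]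
    [NormedSpace ℝ E] (G : ℝ) (hG : 0 ≤ G) (T : ℕ) (hT : 1 ≤ T)
    (p : ℕ → X → E) (hp : ∀ t ∈ Finset.Icc 0 T, ∀ x : X, ‖p t x‖ ≤ G)
    (h : ℕ → X → E) (h0 : ∀ x : X, h 0 x = 0)
    (c : ℕ → ℝ) (hc : ∀ t ∈ Finset.Icc 1 T, 0 ≤ c t)
    (hhc : ∀ t ∈ Finset.Icc 1 T, ∀ x : X, ‖h t x‖ ≤ c t)
    (hph : ∀ t ∈ Finset.Icc 1 T, ∀ x : X,
      p t x - p (t - 1) x = h t x - h (t - 1) x) :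
    ∑ t ∈ Finset.Icc 1 T, (⨆ x : X, ‖p t x - p (t - 1) x‖ ^ 2) ≤
      4 * G * ∑ t ∈ Finset.Icc 1 T, c t := by
  set d : ℕ → ℝ := fun t => if t = 0 then 0 else c t with hd
  have hd_eq : ∀ t ∈ Finset.Icc 1 T, d t = c t := fun t ht => by
    rw [Finset.mem_Icc] at ht
    exact if_neg (by omega)
  have hhd : ∀ t ≤ T, ∀ x, ‖h t x‖ ≤ d t := fun t ht x => by
    rcases Nat.eq_zero_or_pos t with rfl | ht0
    · simp [hd, h0]
    · have hmem := Finset.mem_Icc.2 ⟨ht0, ht⟩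
      exact (hhc t hmem x).trans_eq (hd_eq t hmem).symm
  have hterm : ∀ t ∈ Finset.Icc 1 T,
      (⨆ x : X, ‖p t x - p (t - 1) x‖ ^ 2) ≤ 2 * G * (d t + d (t - 1)) := fun t ht => by
    refine ciSup_le fun x => ?_
    have ht' := Finset.mem_Icc.1 ht
    have hpx : ‖p t x - p (t - 1) x‖ ≤ 2 * G := by
      have := norm_sub_le_of_le (hp t (Finset.mem_Icc.2 ⟨by omega, ht'.2⟩) x)
        (hp (t - 1) (Finset.mem_Icc.2 ⟨by omega, by omega⟩) x)
      linarith
    have hhx : ‖p t x - p (t - 1) x‖ ≤ d t + d (t - 1) := by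
      rw [hph t ht x]
      exact norm_sub_le_of_le (hhd t ht'.2 x) (hhd (t - 1) (by omega) x)
    rw [sq]
    exact mul_le_mul hpx hhx (norm_nonneg _) (by positivity)
  have hdT : 0 ≤ d T := by
    have hmem := Finset.mem_Icc.2 ⟨hT, le_rfl⟩
    exact (hd_eq T hmem).symm ▸ hc T hmem
  calc ∑ t ∈ Finset.Icc 1 T, (⨆ x : X, ‖p t x - p (t - 1) x‖ ^ 2)
      ≤ ∑ t ∈ Finset.Icc 1 T, 2 * G * (d t + d (t - 1)) := Finset.sum_le_sum hterm
    _ = 2 * G * (2 * ∑ t ∈ Finset.Icc 1 T, c t - d T) := by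
      rw [← Finset.mul_sum, sum_Icc_add_pred_eq, Finset.sum_congr rfl hd_eq,
        show d 0 = 0 from if_pos rfl, add_zero]
    _ ≤ 4 * G * ∑ t ∈ Finset.Icc 1 T, c t := by
      linarith [mul_nonneg hG hdT]
end
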